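/- arXiv:2008.00200 — 8 statements merged into one kernel-verified Lean document; each statement's English description precedes it below -/
import Mathlib

section
/- The subgroup D is a generalised dihedral group over the additive group (F,+) (in particular |D| = 2q), and the subgroups H and K are generalised dihedral groups over the additive group (F ⊕ F, +) (in particular |H| = |K| = 2q²). Moreover |G| = 4q³. -/
open Matrix

abbrev SL3 (F : Type*) [Field F] := Matrix.SpecialLinearGroup (Fin 3) F

variable (F : Type*) [Field F]

/-- The subgroup `G` of `SL₃(F)`, as a set of matrices. -/
def GSet : Set (SL3 F) :=
  {g | ∃ a b c x y z : F, (a = 1 ∨ a = -1) ∧ (b = 1 ∨ b = -1) ∧ (c = 1 ∨ c = -1) ∧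
    a * b * c = 1 ∧ (g : Matrix (Fin 3) (Fin 3) F) = !![a, x, z; 0, b, y; 0, 0, c]}

/-- The subgroup `D` of `SL₃(F)`, as a set of matrices. -/
def DSet : Set (SL3 F) :=
  {g | ∃ a x : F, (a = 1 ∨ a = -1) ∧
    (g : Matrix (Fin 3) (Fin 3) F) = !![a, a * x, a * x ^ 2 / 2; 0, 1, x; 0, 0, a]}

/-- The matrix `h(a,x,y)`. -/
def hMat (a x y : F) : Matrix (Fin 3) (Fin 3) F := !![a, 0, x; 0, a, y; 0, 0, 1]

/-- The subgroup `H` of `SL₃(F)`, as a set of matrices. -/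
def HSet : Set (SL3 F) :=
  {g | ∃ a x y : F, (a = 1 ∨ a = -1) ∧ (g : Matrix (Fin 3) (Fin 3) F) = hMat F a x y}

/-- The subgroup `K` of `SL₃(F)`, as a set of matrices. -/
def KSet : Set (SL3 F) :=
  {g | ∃ a x y : F, (a = 1 ∨ a = -1) ∧
    (g : Matrix (Fin 3) (Fin 3) F) = !![1, x, y; 0, a, 0; 0, 0, a]}

/-- The singleton set `S_t = {h(1,t,0)}`. -/
def Sorb (t : F) : Set (SL3 F) := {g | (g : Matrix (Fin 3) (Fin 3) F) = hMat F 1 t 0}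

/-- The set `C_t = {h(1,z,t) : z ∈ F}`. -/
def Corb (t : F) : Set (SL3 F) := {g | ∃ z : F, (g : Matrix (Fin 3) (Fin 3) F) = hMat F 1 z t}

/-- The parabolic set `P_t = {h(-1,t+z²,2z) : z ∈ F}`. -/
def Porb (t : F) : Set (SL3 F) :=
  {g | ∃ z : F, (g : Matrix (Fin 3) (Fin 3) F) = hMat F (-1) (t + z ^ 2) (2 * z)}

/-- The orbit of `h` under the conjugation action of `D`. -/
def DOrbit (h : SL3 F) : Set (SL3 F) := {h' | ∃ d ∈ DSet F, h' = d⁻¹ * h * d}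

/-- `R` is a generalised dihedral group over the abelian group `A`. -/
def IsGeneralizedDihedral (A : Type*) (R : Type*) [CommGroup A] [Group R] : Prop :=
  ∃ (ι : A →* R) (x : R), Function.Injective ι ∧ x ^ 2 = 1 ∧ x ∉ ι.range ∧
    (∀ a : A, x⁻¹ * ι a * x = ι a⁻¹) ∧ (∀ r : R, r ∈ ι.range ∨ ∃ a : A, r = ι a * x)

namespace IsGeneralizedDihedral

variable {A R : Type*} [CommGroup A] [Group R]

theorem natCard_eq [Finite A] (h : IsGeneralizedDihedral A R) :
    Nat.card R = 2 * Nat.card A := by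
  obtain ⟨ι, x, hι, -, hx, -, hsurj⟩ := h
  have hmix (a b : A) : ι a ≠ ι b * x := fun hab =>
    hx ⟨b⁻¹ * a, by rw [map_mul, map_inv, hab, inv_mul_cancel_left]⟩
  have hbij : Function.Bijective (Sum.elim ι fun a => ι a * x) := by
    refine ⟨hι.sumElim (fun a b hab => hι (mul_right_cancel hab)) hmix, fun r => ?_⟩
    rcases hsurj r with ⟨a, ha⟩ | ⟨a, ha⟩
    · exact ⟨.inl a, ha⟩
    · exact ⟨.inr a, ha.symm⟩
  rw [← Nat.card_eq_of_bijective _ hbij, Nat.card_sum, two_mul]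

theorem of_subgroup {P : Subgroup R} (ι : A →* R) (x : R) (hι : Function.Injective ι)
    (hx2 : x ^ 2 = 1) (hx : ∀ a, ι a ≠ x) (hconj : ∀ a, x * ι a * x = ι a⁻¹)
    (hP : ∀ r, r ∈ P ↔ (∃ a, r = ι a) ∨ ∃ a, r = ι a * x) :
    IsGeneralizedDihedral A P := by
  have hxP : x ∈ P := (hP x).2 (.inr ⟨1, by simp⟩)
  have hxinv : x⁻¹ = x := inv_eq_of_mul_eq_one_left (by rw [← sq, hx2])
  refine ⟨ι.codRestrict P fun a => (hP _).2 (.inl ⟨a, rfl⟩), ⟨x, hxP⟩, fun a b hab => ?_,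
    Subtype.ext hx2, ?_, fun a => Subtype.ext ?_, fun r => ?_⟩
  · exact hι (congrArg Subtype.val hab)
  · rintro ⟨a, ha⟩
    exact hx a (congrArg Subtype.val ha)
  · simpa [hxinv] using hconj a
  · rcases (hP r).1 r.2 with ⟨a, ha⟩ | ⟨a, ha⟩
    · exact .inl ⟨a, Subtype.ext ha.symm⟩
    · exact .inr ⟨a, Subtype.ext ha⟩

end IsGeneralizedDihedral

namespace SL3

variable {F : Type*} [Field F]

/-- The upper triangular matrix with diagonal `(a, b, c)` and entries `x, y, z` in the positions
`(1, 2)`, `(2, 3)`, `(1, 3)`. -/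
def upper (a b c x y z : F) (h : a * b * c = 1) : SL3 F :=
  ⟨!![a, x, z; 0, b, y; 0, 0, c], by simp [Matrix.det_fin_three, h]⟩

theorem eq_upper_iff {g : SL3 F} {a b c x y z : F} {h} :
    g = upper a b c x y z h ↔
      (g : Matrix (Fin 3) (Fin 3) F) = !![a, x, z; 0, b, y; 0, 0, c] :=
  Subtype.ext_iff

theorem upper_mul (a b c x y z a' b' c' x' y' z' : F) (h h') :
    upper a b c x y z h * upper a' b' c' x' y' z' h' =
      upper (a * a') (b * b') (c * c') (a * x' + x * b') (b * y' + y * c')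
        (a * z' + x * y' + z * c') (by linear_combination h' + a' * b' * c' * h) := by
  rw [eq_upper_iff, Matrix.SpecialLinearGroup.coe_mul]
  simp [upper, add_assoc]

theorem upper_one : upper 1 1 1 0 0 0 (by simp) = (1 : SL3 F) :=
  Subtype.ext Matrix.one_fin_three.symm

theorem upper_inj {a b c x y z a' b' c' x' y' z' : F} {h h'} :
    upper a b c x y z h = upper a' b' c' x' y' z' h' ↔
      a = a' ∧ b = b' ∧ c = c' ∧ x = x' ∧ y = y' ∧ z = z' := by
  rw [eq_upper_iff]
  simp [upper]
  tauto

/-- The unipotent subgroup of `D`. -/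
def unipotentD (h2 : (2 : F) ≠ 0) : Multiplicative F →* SL3 F where
  toFun x := upper 1 1 1 x.toAdd x.toAdd (x.toAdd ^ 2 / 2) (by simp)
  map_one' := by simp [upper_one]
  map_mul' x y := by
    rw [upper_mul, upper_inj]
    simp only [toAdd_mul]
    refine ⟨by ring, by ring, by ring, by ring, by ring, ?_⟩
    field_simp
    ring

/-- The unipotent subgroup of `H`. -/
def unipotentH : Multiplicative (F × F) →* SL3 F where
  toFun p := upper 1 1 1 0 p.toAdd.2 p.toAdd.1 (by simp)
  map_one' := by simp [upper_one]
  map_mul' x y := by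
    rw [upper_mul, upper_inj]
    simp [add_comm]

/-- The unipotent subgroup of `K`. -/
def unipotentK : Multiplicative (F × F) →* SL3 F where
  toFun p := upper 1 1 1 p.toAdd.1 0 p.toAdd.2 (by simp)
  map_one' := by simp [upper_one]
  map_mul' x y := by
    rw [upper_mul, upper_inj]
    simp [add_comm]

theorem isGeneralizedDihedral_of_eq_DSet (h2 : (2 : F) ≠ 0) (h1 : (-1 : F) ≠ 1)
    {D : Subgroup (SL3 F)} (hD : (D : Set (SL3 F)) = DSet F) :
    IsGeneralizedDihedral (Multiplicative F) D := by
  refine .of_subgroup (unipotentD h2) (upper (-1) 1 (-1) 0 0 0 (by simp)) (fun x y h => ?_) ?_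
    (fun x h => ?_) (fun x => ?_) fun r => ?_
  · exact Multiplicative.toAdd.injective ((upper_inj (h := by simp) (h' := by simp)).1 h).2.2.2.1
  · rw [sq, upper_mul, ← upper_one, upper_inj]
    simp
  · exact h1 ((upper_inj (h := by simp) (h' := by simp)).1 h).1.symm
  · simp only [unipotentD, MonoidHom.coe_mk, OneHom.coe_mk, upper_mul, upper_inj]
    simp
  · rw [← SetLike.mem_coe, hD]
    simp only [unipotentD, MonoidHom.coe_mk, OneHom.coe_mk, upper_mul, eq_upper_iff]
    constructor
    · rintro ⟨a, x, rfl | rfl, h⟩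
      · exact .inl ⟨.ofAdd x, by simpa using h⟩
      · exact .inr ⟨.ofAdd (-x), by simpa [neg_div] using h⟩
    · rintro (⟨x, h⟩ | ⟨x, h⟩)
      · exact ⟨1, x.toAdd, .inl rfl, by simpa using h⟩
      · exact ⟨-1, -x.toAdd, .inr rfl, by simpa [neg_div] using h⟩

theorem isGeneralizedDihedral_of_eq_HSet (h1 : (-1 : F) ≠ 1)
    {H : Subgroup (SL3 F)} (hH : (H : Set (SL3 F)) = HSet F) :
    IsGeneralizedDihedral (Multiplicative (F × F)) H := by
  refine .of_subgroup unipotentH (upper (-1) (-1) 1 0 0 0 (by simp)) (fun p q h => ?_) ?_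
    (fun p h => ?_) (fun p => ?_) fun r => ?_
  · obtain ⟨-, -, -, -, hy, hx⟩ := (upper_inj (h := by simp) (h' := by simp)).1 h
    exact Multiplicative.toAdd.injective (Prod.ext hx hy)
  · rw [sq, upper_mul, ← upper_one, upper_inj]
    simp
  · exact h1 ((upper_inj (h := by simp) (h' := by simp)).1 h).1.symm
  · simp only [unipotentH, MonoidHom.coe_mk, OneHom.coe_mk, upper_mul, upper_inj]
    simp
  · rw [← SetLike.mem_coe, hH]
    simp only [unipotentH, MonoidHom.coe_mk, OneHom.coe_mk, upper_mul, eq_upper_iff]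
    constructor
    · rintro ⟨a, x, y, rfl | rfl, h⟩
      · exact .inl ⟨.ofAdd (x, y), by simpa [hMat] using h⟩
      · exact .inr ⟨.ofAdd (x, y), by simpa [hMat] using h⟩
    · rintro (⟨p, h⟩ | ⟨p, h⟩)
      · exact ⟨1, p.toAdd.1, p.toAdd.2, .inl rfl, by simpa [hMat] using h⟩
      · exact ⟨-1, p.toAdd.1, p.toAdd.2, .inr rfl, by simpa [hMat] using h⟩

theorem isGeneralizedDihedral_of_eq_KSet (h1 : (-1 : F) ≠ 1)
    {K : Subgroup (SL3 F)} (hK : (K : Set (SL3 F)) = KSet F) :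
    IsGeneralizedDihedral (Multiplicative (F × F)) K := by
  refine .of_subgroup unipotentK (upper 1 (-1) (-1) 0 0 0 (by simp)) (fun p q h => ?_) ?_
    (fun p h => ?_) (fun p => ?_) fun r => ?_
  · obtain ⟨-, -, -, hx, -, hy⟩ := (upper_inj (h := by simp) (h' := by simp)).1 h
    exact Multiplicative.toAdd.injective (Prod.ext hx hy)
  · rw [sq, upper_mul, ← upper_one, upper_inj]
    simp
  · exact h1 ((upper_inj (h := by simp) (h' := by simp)).1 h).2.1.symm
  · simp only [unipotentK, MonoidHom.coe_mk, OneHom.coe_mk, upper_mul, upper_inj]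
    simp
  · rw [← SetLike.mem_coe, hK]
    simp only [unipotentK, MonoidHom.coe_mk, OneHom.coe_mk, upper_mul, eq_upper_iff]
    constructor
    · rintro ⟨a, x, y, rfl | rfl, h⟩
      · exact .inl ⟨.ofAdd (x, y), by simpa using h⟩
      · exact .inr ⟨.ofAdd (-x, -y), by simpa using h⟩
    · rintro (⟨p, h⟩ | ⟨p, h⟩)
      · exact ⟨1, p.toAdd.1, p.toAdd.2, .inl rfl, by simpa using h⟩
      · exact ⟨-1, -p.toAdd.1, -p.toAdd.2, .inr rfl, by simpa using h⟩

theorem natCard_GSet [Fintype F] (h1 : (-1 : F) ≠ 1) :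
    Nat.card (GSet F) = 4 * Fintype.card F ^ 3 := by
  let s : Bool → F := fun b => if b then 1 else -1
  have hs : Function.Injective s := by
    rintro (_ | _) (_ | _) h <;> simp_all [s, eq_comm]
  have hs1 (b : Bool) : s b = 1 ∨ s b = -1 := by cases b <;> simp [s]
  have hsq (b : Bool) : s b * s b = 1 := by cases b <;> simp [s]
  let f : Bool × Bool × F × F × F → SL3 F := fun p =>
    upper (s p.1) (s p.2.1) (s p.1 * s p.2.1) p.2.2.1 p.2.2.2.1 p.2.2.2.2
      (by rw [mul_mul_mul_comm, hsq, hsq, one_mul])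
  have hf : Function.Injective f := by
    rintro ⟨a, b, x, y, z⟩ ⟨a', b', x', y', z'⟩ h
    obtain ⟨ha, hb, -, hx, hy, hz⟩ := upper_inj.1 h
    exact Prod.ext (hs ha) (Prod.ext (hs hb) (Prod.ext hx (Prod.ext hy hz)))
  have hrange : Set.range f = GSet F := by
    ext g
    constructor
    · rintro ⟨p, rfl⟩
      refine ⟨_, _, _, _, _, _, hs1 _, hs1 _, ?_, ?_, rfl⟩
      · rcases hs1 p.1 with h | h <;> rcases hs1 p.2.1 with h' | h' <;> simp [h, h']
      · rw [mul_mul_mul_comm, hsq, hsq, one_mul]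
    · rintro ⟨a, b, c, x, y, z, ha, hb, -, habc, h⟩
      have hsurj {t : F} (ht : t = 1 ∨ t = -1) : ∃ i, s i = t := by
        rcases ht with rfl | rfl
        · exact ⟨true, rfl⟩
        · exact ⟨false, rfl⟩
      obtain ⟨i, rfl⟩ := hsurj ha
      obtain ⟨j, rfl⟩ := hsurj hb
      have hc : s i * s j = c := by
        linear_combination -(s i * s j) * habc + c * hsq i + c * s i ^ 2 * hsq j
      exact ⟨(i, j, x, y, z), (eq_upper_iff.2 (by rw [h, hc])).symm⟩
  rw [← hrange, Nat.card_range_of_injective hf]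
  simp only [Nat.card_eq_fintype_card, Fintype.card_prod, Fintype.card_bool]
  ring

end SL3

theorem stmt3 (F : Type*) [Field F] [Fintype F] (hodd : Odd (Fintype.card F))
    (G D H K : Subgroup (SL3 F))
    (hG : (G : Set (SL3 F)) = GSet F) (hD : (D : Set (SL3 F)) = DSet F)
    (hH : (H : Set (SL3 F)) = HSet F) (hK : (K : Set (SL3 F)) = KSet F) :
    IsGeneralizedDihedral (Multiplicative F) D ∧ Nat.card D = 2 * Fintype.card F ∧
    IsGeneralizedDihedral (Multiplicative (F × F)) H ∧
    IsGeneralizedDihedral (Multiplicative (F × F)) K ∧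
    Nat.card H = 2 * Fintype.card F ^ 2 ∧ Nat.card K = 2 * Fintype.card F ^ 2 ∧
    Nat.card G = 4 * Fintype.card F ^ 3 := by
  have h2 : (2 : F) ≠ 0 := Ring.two_ne_zero fun h =>
    Nat.not_even_iff_odd.2 hodd (Nat.even_iff.2 (FiniteField.even_card_of_char_two h))
  have h1 : (-1 : F) ≠ 1 := fun h => h2 (by linear_combination -h)
  have hD' := SL3.isGeneralizedDihedral_of_eq_DSet h2 h1 hD
  have hH' := SL3.isGeneralizedDihedral_of_eq_HSet h1 hH
  have hK' := SL3.isGeneralizedDihedral_of_eq_KSet h1 hK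
  have hF : Nat.card (Multiplicative F) = Fintype.card F := by
    rw [Nat.card_congr Multiplicative.toAdd, Nat.card_eq_fintype_card]
  have hFF : Nat.card (Multiplicative (F × F)) = Fintype.card F ^ 2 := by
    rw [Nat.card_congr Multiplicative.toAdd, Nat.card_prod, Nat.card_eq_fintype_card, sq]
  refine ⟨hD', by rw [hD'.natCard_eq, hF], hH', hK', by rw [hH'.natCard_eq, hFF],
    by rw [hK'.natCard_eq, hFF], ?_⟩
  rw [← SL3.natCard_GSet h1, ← hG]
  rfl
end

section
/- The core of D in G (the largest normal subgroup of G contained in D, equivalently the intersection of all G-conjugates of D) is trivial. Moreover DK = DH = G = HD = KD and D ∩ H = 1 = D ∩ K. -/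
open Matrix Pointwise

variable (F : Type*) [Field F]

section

variable {F}

theorem det_upperTriangular (a b c x y z : F) :
    (!![a, x, z; 0, b, y; 0, 0, c] : Matrix (Fin 3) (Fin 3) F).det = a * b * c := by
  simp [det_fin_three]

theorem mul_self_eq_one_of_sign {a : F} (ha : a = 1 ∨ a = -1) : a * a = 1 := by
  rcases ha with rfl | rfl <;> simp

theorem DSet_subset_GSet : DSet F ⊆ GSet F := by
  rintro g ⟨a, x, ha, hg⟩
  exact ⟨a, 1, a, _, _, _, ha, Or.inl rfl, ha, by simpa using mul_self_eq_one_of_sign ha, hg⟩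

theorem HSet_subset_GSet : HSet F ⊆ GSet F := by
  rintro g ⟨a, x, y, ha, hg⟩
  exact ⟨a, a, 1, _, _, _, ha, ha, Or.inl rfl, by simpa using mul_self_eq_one_of_sign ha, hg⟩

theorem KSet_subset_GSet : KSet F ⊆ GSet F := by
  rintro g ⟨a, x, y, ha, hg⟩
  exact ⟨1, a, a, _, _, _, Or.inl rfl, ha, ha, by simpa using mul_self_eq_one_of_sign ha, hg⟩

theorem GSet_subset_DSet_mul_KSet : GSet F ⊆ DSet F * KSet F := by
  rintro g ⟨a, b, c, x, y, z, ha, hb, hc, habc, hg⟩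
  have ha2 := mul_self_eq_one_of_sign ha
  have hb2 := mul_self_eq_one_of_sign hb
  have hcab : a * b = c := by linear_combination c * habc - a * b * mul_self_eq_one_of_sign hc
  let d : SL3 F := ⟨!![a, a * (y * b), a * (y * b) ^ 2 / 2; 0, 1, y * b; 0, 0, a], by
    rw [det_upperTriangular, mul_one, ha2]⟩
  let k : SL3 F := ⟨!![1, a * x - y, a * z - (y * b) ^ 2 / 2 * b; 0, b, 0; 0, 0, b], by
    rw [det_upperTriangular, one_mul, hb2]⟩
  refine ⟨d, ⟨a, y * b, ha, rfl⟩, k, ⟨b, _, _, hb, rfl⟩, ?_⟩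
  apply Subtype.ext
  change d.1 * k.1 = g.1
  rw [hg]
  ext i j
  fin_cases i <;> fin_cases j <;> simp [d, k, Matrix.mul_apply, Fin.sum_univ_three, hcab]
  · linear_combination x * ha2 + a * y * hb2
  · linear_combination z * ha2
  · linear_combination y * hb2

theorem GSet_subset_DSet_mul_HSet : GSet F ⊆ DSet F * HSet F := by
  rintro g ⟨a, b, c, x, y, z, ha, hb, hc, habc, hg⟩
  have ha2 := mul_self_eq_one_of_sign ha
  have hb2 := mul_self_eq_one_of_sign hb
  have hc2 := mul_self_eq_one_of_sign hc
  have hacb : c * b = a := by linear_combination a * habc - c * b * ha2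
  let d : SL3 F := ⟨!![c, c * (a * x), c * (a * x) ^ 2 / 2; 0, 1, a * x; 0, 0, c], by
    rw [det_upperTriangular, mul_one, hc2]⟩
  let h : SL3 F := ⟨!![b, 0, c * z - a * x * (y - a * x) - (a * x) ^ 2 / 2;
      0, b, y - a * x; 0, 0, 1], by
    rw [det_upperTriangular, mul_one, hb2]⟩
  refine ⟨d, ⟨c, a * x, hc, rfl⟩, h, ⟨b, _, _, hb, rfl⟩, ?_⟩
  apply Subtype.ext
  change d.1 * h.1 = g.1
  rw [hg]
  ext i j
  fin_cases i <;> fin_cases j <;> simp [d, h, Matrix.mul_apply, Fin.sum_univ_three, hacb]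
  · linear_combination a * x * hacb + x * ha2
  · linear_combination z * hc2

theorem eq_one_of_mem_DSet_of_mem_HSet {g : SL3 F} (hD : g ∈ DSet F) (hH : g ∈ HSet F) :
    g = 1 := by
  obtain ⟨a, x, ha, hg⟩ := hD
  obtain ⟨b, u, v, hb, hg'⟩ := hH
  have h := hg.symm.trans hg'
  have h22 : a = 1 := by simpa [hMat] using congrFun₂ h 2 2
  have h01 : x = 0 := by simpa [hMat, h22] using congrFun₂ h 0 1
  apply Subtype.ext
  rw [hg, h22, h01]
  ext i j
  fin_cases i <;> fin_cases j <;> simp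

theorem eq_one_of_mem_DSet_of_mem_KSet {g : SL3 F} (hD : g ∈ DSet F) (hK : g ∈ KSet F) :
    g = 1 := by
  obtain ⟨a, x, ha, hg⟩ := hD
  obtain ⟨b, u, v, hb, hg'⟩ := hK
  have h := hg.symm.trans hg'
  have h00 : a = 1 := by simpa using congrFun₂ h 0 0
  have h12 : x = 0 := by simpa using congrFun₂ h 1 2
  apply Subtype.ext
  rw [hg, h00, h12]
  ext i j
  fin_cases i <;> fin_cases j <;> simp

theorem eq_one_of_forall_conj_mem_DSet (h2 : (2 : F) ≠ 0) {x : SL3 F}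
    (hx : ∀ g ∈ GSet F, g * x * g⁻¹ ∈ DSet F) : x = 1 := by
  have one_mem : (1 : SL3 F) ∈ GSet F := by
    refine ⟨1, 1, 1, 0, 0, 0, by simp, by simp, by simp, by simp, ?_⟩
    ext i j
    fin_cases i <;> fin_cases j <;> simp
  obtain ⟨a, t, ha, hxa⟩ : x ∈ DSet F := by simpa using hx 1 one_mem
  have conj : ∀ g ∈ GSet F, ∃ b s : F,
      g.1 * x.1 = !![b, b * s, b * s ^ 2 / 2; 0, 1, s; 0, 0, b] * g.1 := by
    intro g hg
    obtain ⟨b, s, -, hb⟩ := hx g hg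
    refine ⟨b, s, ?_⟩
    rw [← hb]
    exact congrArg Subtype.val (inv_mul_cancel_right (g * x) g).symm
  have ht : t = 0 := by
    let g : SL3 F := ⟨!![-1, 0, 0; 0, -1, 0; 0, 0, 1], by rw [det_upperTriangular]; simp⟩
    obtain ⟨b, s, h⟩ := conj g ⟨-1, -1, 1, 0, 0, 0, by simp, by simp, by simp, by simp, rfl⟩
    rw [hxa] at h
    have h22 : a = b := by
      simpa [g, Matrix.mul_apply, Fin.sum_univ_three] using congrFun₂ h 2 2
    have h01 : a * t = b * s := by
      simpa [g, Matrix.mul_apply, Fin.sum_univ_three] using congrFun₂ h 0 1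
    have h12 : -t = s := by
      simpa [g, Matrix.mul_apply, Fin.sum_univ_three] using congrFun₂ h 1 2
    have : 2 * t = 0 := by
      subst h22 h12
      linear_combination a * h01 - 2 * t * mul_self_eq_one_of_sign ha
    exact (mul_eq_zero.mp this).resolve_left h2
  have ha1 : a = 1 := by
    let g : SL3 F := ⟨!![1, 1, 0; 0, 1, 0; 0, 0, 1], by rw [det_upperTriangular]; simp⟩
    obtain ⟨b, s, h⟩ := conj g ⟨1, 1, 1, 1, 0, 0, by simp, by simp, by simp, by simp, rfl⟩
    rw [hxa, ht] at h
    have h12 : s = 0 := by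
      simpa [g, Matrix.mul_apply, Fin.sum_univ_three, eq_comm] using congrFun₂ h 1 2
    have h22 : a = b := by
      simpa [g, Matrix.mul_apply, Fin.sum_univ_three] using congrFun₂ h 2 2
    have h01 : 1 = b := by
      simpa [g, Matrix.mul_apply, Fin.sum_univ_three, h12] using congrFun₂ h 0 1
    rw [h22, h01]
  apply Subtype.ext
  rw [hxa, ha1, ht]
  ext i j
  fin_cases i <;> fin_cases j <;> simp

theorem Subgroup.mul_eq_of_le_of_subset_mul {M : Type*} [Group M] {A B C : Subgroup M}
    (hA : A ≤ C) (hB : B ≤ C) (h : (C : Set M) ⊆ A * B) : (A : Set M) * B = C := by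
  refine Set.Subset.antisymm ?_ h
  rintro _ ⟨a, ha, b, hb, rfl⟩
  exact C.mul_mem (hA ha) (hB hb)

theorem Subgroup.mul_comm_of_mul_eq {M : Type*} [Group M] {A B C : Subgroup M}
    (h : (A : Set M) * B = C) : (B : Set M) * A = C := by
  simpa only [_root_.mul_inv_rev, inv_coe_set] using congrArg (·⁻¹) h

end

theorem stmt4 (F : Type*) [Field F] [Fintype F] (hodd : Odd (Fintype.card F))
    (G D H K : Subgroup (SL3 F))
    (hG : (G : Set (SL3 F)) = GSet F) (hD : (D : Set (SL3 F)) = DSet F)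
    (hH : (H : Set (SL3 F)) = HSet F) (hK : (K : Set (SL3 F)) = KSet F) :
    -- the largest normal subgroup of `G` contained in `D` is trivial
    (∀ N : Subgroup (SL3 F), N ≤ G → N ≤ D →
      (∀ g ∈ G, ∀ n ∈ N, g * n * g⁻¹ ∈ N) → N = ⊥) ∧
    -- equivalently, the intersection of all `G`-conjugates of `D` is trivial
    (∀ x : SL3 F, (∀ g ∈ G, g * x * g⁻¹ ∈ D) → x = 1) ∧
    -- `DK = DH = G = HD = KD`
    (D : Set (SL3 F)) * (K : Set (SL3 F)) = (G : Set (SL3 F)) ∧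
    (D : Set (SL3 F)) * (H : Set (SL3 F)) = (G : Set (SL3 F)) ∧
    (H : Set (SL3 F)) * (D : Set (SL3 F)) = (G : Set (SL3 F)) ∧
    (K : Set (SL3 F)) * (D : Set (SL3 F)) = (G : Set (SL3 F)) ∧
    -- `D ∩ H = 1 = D ∩ K`
    D ⊓ H = ⊥ ∧ D ⊓ K = ⊥ := by
  have h2 : (2 : F) ≠ 0 := Ring.two_ne_zero fun h =>
    Nat.not_even_iff_odd.mpr hodd (Nat.even_iff.mpr (FiniteField.even_card_of_char_two h))
  have core : ∀ x : SL3 F, (∀ g ∈ G, g * x * g⁻¹ ∈ D) → x = 1 := by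
    simp only [← SetLike.mem_coe, hG, hD]
    exact fun x => eq_one_of_forall_conj_mem_DSet h2
  have hDG : D ≤ G := by
    rw [← SetLike.coe_subset_coe, hD, hG]
    exact DSet_subset_GSet
  have hHG : H ≤ G := by
    rw [← SetLike.coe_subset_coe, hH, hG]
    exact HSet_subset_GSet
  have hKG : K ≤ G := by
    rw [← SetLike.coe_subset_coe, hK, hG]
    exact KSet_subset_GSet
  have hDK := Subgroup.mul_eq_of_le_of_subset_mul hDG hKG <| by
    rw [hD, hK, hG]
    exact GSet_subset_DSet_mul_KSet
  have hDH := Subgroup.mul_eq_of_le_of_subset_mul hDG hHG <| by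
    rw [hD, hH, hG]
    exact GSet_subset_DSet_mul_HSet
  refine ⟨fun N _ hND hN => (Subgroup.eq_bot_iff_forall N).mpr fun n hn =>
      core n fun g hg => hND (hN g hg n hn), core, hDK, hDH,
    Subgroup.mul_comm_of_mul_eq hDH, Subgroup.mul_comm_of_mul_eq hDK, ?_, ?_⟩
  · rw [Subgroup.eq_bot_iff_forall]
    rintro g ⟨hgD, hgH⟩
    exact eq_one_of_mem_DSet_of_mem_HSet (hD ▸ hgD) (hH ▸ hgH)
  · rw [Subgroup.eq_bot_iff_forall]
    rintro g ⟨hgD, hgK⟩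
    exact eq_one_of_mem_DSet_of_mem_KSet (hD ▸ hgD) (hK ▸ hgK)
end

section
/- In the action of G by right multiplication on the set D\G = { Dg : g ∈ G } of right cosets of D in G, the group G acts faithfully, and both H and K act regularly (transitively with trivial point stabilisers). -/
open Matrix Pointwise

variable (F : Type*) [Field F]

theorem Subgroup.coe_mul_singleton_eq_iff {M : Type*} [Group M] (D : Subgroup M) (a b : M) :
    (D : Set M) * {a} = (D : Set M) * {b} ↔ ∃ d ∈ D, a = d * b := by
  constructor
  · intro h
    have ha : a ∈ (D : Set M) * {a} := ⟨1, D.one_mem, a, rfl, one_mul a⟩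
    rw [h] at ha
    obtain ⟨d, hd, _, rfl, rfl⟩ := ha
    exact ⟨d, hd, rfl⟩
  · rintro ⟨d, hd, rfl⟩
    rw [← Set.singleton_mul_singleton, ← mul_assoc, Subgroup.subgroup_mul_singleton hd]

theorem two_ne_zero_of_odd_card {F : Type*} [Field F] [Fintype F]
    (hodd : Odd (Fintype.card F)) : (2 : F) ≠ 0 := by
  intro h
  have hchar : ringChar F = 2 :=
    ((Nat.dvd_prime Nat.prime_two).1 (ringChar.dvd (by exact_mod_cast h))).resolve_left
      CharP.ringChar_ne_one
  exact Nat.not_even_iff_odd.2 hodd (Nat.even_iff.2 (FiniteField.even_card_iff_char_two.1 hchar))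

theorem mul_self_of_sign {F : Type*} [Field F] {a : F} (h : a = 1 ∨ a = -1) : a * a = 1 :=
  mul_self_eq_one_iff.2 h

theorem SL3.mul_eq_mul_iff {F : Type*} [Field F] {g h k l : SL3 F} :
    g * h = k * l ↔ (g : Matrix (Fin 3) (Fin 3) F) * (h : Matrix (Fin 3) (Fin 3) F) =
      (k : Matrix (Fin 3) (Fin 3) F) * (l : Matrix (Fin 3) (Fin 3) F) :=
  Subtype.ext_iff

theorem SL3.exists_coe_eq {F : Type*} [Field F] {A : Matrix (Fin 3) (Fin 3) F}
    (hA : A.det = 1) : ∃ g : SL3 F, (g : Matrix (Fin 3) (Fin 3) F) = A :=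
  ⟨⟨A, hA⟩, rfl⟩

theorem eq_one_of_mul_eq_of_mem_HSet {F : Type*} [Field F] {g h d : SL3 F}
    (hg : g ∈ GSet F) (hh : h ∈ HSet F) (hd : d ∈ DSet F) (e : g * h = d * g) : h = 1 := by
  obtain ⟨a, b, c, x, y, z, ha, hb, hc, -, hg⟩ := hg
  obtain ⟨u, p, q, hu, hh⟩ := hh
  obtain ⟨v, w, hv, hd⟩ := hd
  replace ha := mul_self_of_sign ha
  replace hb := mul_self_of_sign hb
  have em := SL3.mul_eq_mul_iff.1 e
  rw [hg, hh, hd, hMat] at em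
  have e00 := congrFun₂ em 0 0
  have e11 := congrFun₂ em 1 1
  have e01 := congrFun₂ em 0 1
  simp [Matrix.mul_apply, Fin.sum_univ_three] at e00 e11 e01
  have hu : u = 1 := by grind
  have hv : v = 1 := by grind
  have hw : w = 0 := by grind
  have hd1 : d = 1 := Subtype.ext (by simp [hd, hv, hw, Matrix.one_fin_three])
  rw [hd1, one_mul] at e
  exact mul_eq_left.1 e

theorem eq_one_of_mul_eq_of_mem_KSet {F : Type*} [Field F] {g k d : SL3 F}
    (hg : g ∈ GSet F) (hk : k ∈ KSet F) (hd : d ∈ DSet F) (e : g * k = d * g) : k = 1 := by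
  obtain ⟨a, b, c, x, y, z, ha, hb, hc, -, hg⟩ := hg
  obtain ⟨u, p, q, hu, hk⟩ := hk
  obtain ⟨v, w, hv, hd⟩ := hd
  replace ha := mul_self_of_sign ha
  replace hb := mul_self_of_sign hb
  have em := SL3.mul_eq_mul_iff.1 e
  rw [hg, hk, hd] at em
  have e00 := congrFun₂ em 0 0
  have e11 := congrFun₂ em 1 1
  have e12 := congrFun₂ em 1 2
  simp [Matrix.mul_apply, Fin.sum_univ_three] at e00 e11 e12
  have hu : u = 1 := by grind
  have hv : v = 1 := by grind
  have hw : w = 0 := by grind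
  have hd1 : d = 1 := Subtype.ext (by simp [hd, hv, hw, Matrix.one_fin_three])
  rw [hd1, one_mul] at e
  exact mul_eq_left.1 e

theorem exists_HSet_mul_eq {F : Type*} [Field F] {g₁ g₂ : SL3 F}
    (hg₁ : g₁ ∈ GSet F) (hg₂ : g₂ ∈ GSet F) :
    ∃ h ∈ HSet F, ∃ d ∈ DSet F, g₁ * h = d * g₂ := by
  obtain ⟨a, b, c, x, y, z, ha, hb, hc, habc, hg₁⟩ := hg₁
  obtain ⟨a', b', c', x', y', z', ha', hb', hc', habc', hg₂⟩ := hg₂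
  replace ha := mul_self_of_sign ha
  replace hb := mul_self_of_sign hb
  replace hc := mul_self_of_sign hc
  replace ha' := mul_self_of_sign ha'
  replace hb' := mul_self_of_sign hb'
  replace hc' := mul_self_of_sign hc'
  obtain ⟨u, hu⟩ : ∃ u, u = b * b' := ⟨_, rfl⟩
  obtain ⟨v, hv⟩ : ∃ v, v = c * c' := ⟨_, rfl⟩
  obtain ⟨w, hw⟩ : ∃ w, w = b' * (v * x * u - x') := ⟨_, rfl⟩
  obtain ⟨s, hs⟩ : ∃ s, s = v * w ^ 2 / 2 := ⟨_, rfl⟩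
  obtain ⟨q, hq⟩ : ∃ q, q = b * (y' + w * c' - y) := ⟨_, rfl⟩
  obtain ⟨p, hp⟩ : ∃ p, p = a * (v * z' + v * w * y' + s * c' - x * q - z) := ⟨_, rfl⟩
  have huu : u * u = 1 := by grind
  have hvv : v * v = 1 := by grind
  obtain ⟨h, hh⟩ := SL3.exists_coe_eq (A := hMat F u p q) (by
    simp [hMat, Matrix.det_fin_three, huu])
  obtain ⟨d, hd⟩ := SL3.exists_coe_eq (A := !![v, v * w, s; 0, 1, w; 0, 0, v]) (by
    simp [Matrix.det_fin_three, hvv])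
  refine ⟨h, ⟨u, p, q, mul_self_eq_one_iff.1 huu, hh⟩,
    d, ⟨v, w, mul_self_eq_one_iff.1 hvv, by rw [hd, hs]⟩, ?_⟩
  clear hs
  rw [SL3.mul_eq_mul_iff, hg₁, hg₂, hh, hd, hMat]
  ext i j
  fin_cases i <;> fin_cases j <;> simp [Matrix.mul_apply, Fin.sum_univ_three] <;> grind

theorem exists_KSet_mul_eq {F : Type*} [Field F] {g₁ g₂ : SL3 F}
    (hg₁ : g₁ ∈ GSet F) (hg₂ : g₂ ∈ GSet F) :
    ∃ k ∈ KSet F, ∃ d ∈ DSet F, g₁ * k = d * g₂ := by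
  obtain ⟨a, b, c, x, y, z, ha, hb, hc, habc, hg₁⟩ := hg₁
  obtain ⟨a', b', c', x', y', z', ha', hb', hc', habc', hg₂⟩ := hg₂
  replace ha := mul_self_of_sign ha
  replace hb := mul_self_of_sign hb
  replace hc := mul_self_of_sign hc
  replace ha' := mul_self_of_sign ha'
  replace hb' := mul_self_of_sign hb'
  replace hc' := mul_self_of_sign hc'
  obtain ⟨u, hu⟩ : ∃ u, u = b * b' := ⟨_, rfl⟩
  obtain ⟨v, hv⟩ : ∃ v, v = a * a' := ⟨_, rfl⟩
  obtain ⟨w, hw⟩ : ∃ w, w = c' * (y * u - y') := ⟨_, rfl⟩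
  obtain ⟨s, hs⟩ : ∃ s, s = v * w ^ 2 / 2 := ⟨_, rfl⟩
  obtain ⟨p, hp⟩ : ∃ p, p = a * (v * x' + v * w * b' - x * u) := ⟨_, rfl⟩
  obtain ⟨q, hq⟩ : ∃ q, q = a * (v * z' + v * w * y' + s * c' - z * u) := ⟨_, rfl⟩
  have huu : u * u = 1 := by grind
  have hvv : v * v = 1 := by grind
  obtain ⟨h, hh⟩ := SL3.exists_coe_eq (A := !![1, p, q; 0, u, 0; 0, 0, u]) (by
    simp [Matrix.det_fin_three, huu])
  obtain ⟨d, hd⟩ := SL3.exists_coe_eq (A := !![v, v * w, s; 0, 1, w; 0, 0, v]) (by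
    simp [Matrix.det_fin_three, hvv])
  refine ⟨h, ⟨u, p, q, mul_self_eq_one_iff.1 huu, hh⟩,
    d, ⟨v, w, mul_self_eq_one_iff.1 hvv, by rw [hd, hs]⟩, ?_⟩
  clear hs
  rw [SL3.mul_eq_mul_iff, hg₁, hg₂, hh, hd]
  ext i j
  fin_cases i <;> fin_cases j <;> simp [Matrix.mul_apply, Fin.sum_univ_three] <;> grind

/-- The core of `D` in `G` is trivial. -/
theorem eq_one_of_forall_exists_DSet {F : Type*} [Field F] (h2 : (2 : F) ≠ 0) {g : SL3 F}
    (h : ∀ g' ∈ GSet F, ∃ d ∈ DSet F, g' * g = d * g') : g = 1 := by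
  have hg : g ∈ DSet F := by
    obtain ⟨d, hd, e⟩ := h 1 ⟨1, 1, 1, 0, 0, 0, by simp [Matrix.one_fin_three]⟩
    rw [one_mul, mul_one] at e
    exact e ▸ hd
  obtain ⟨v, w, hv, hg⟩ := hg
  have hvv := mul_self_of_sign hv
  have hw : w = 0 := by
    obtain ⟨k, hk⟩ := SL3.exists_coe_eq (F := F) (A := !![1, 0, 0; 0, -1, 0; 0, 0, -1]) (by
      simp [Matrix.det_fin_three])
    obtain ⟨d, ⟨v', w', -, hd⟩, e⟩ := h k ⟨1, -1, -1, 0, 0, 0, by simp [hk]⟩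
    rw [SL3.mul_eq_mul_iff, hg, hd, hk] at e
    have e00 := congrFun₂ e 0 0
    have e01 := congrFun₂ e 0 1
    have e12 := congrFun₂ e 1 2
    simp [Matrix.mul_apply, Fin.sum_univ_three] at e00 e01 e12
    grind
  have hv1 : v = 1 := by
    obtain ⟨k, hk⟩ := SL3.exists_coe_eq (F := F) (A := !![1, 1, 0; 0, 1, 0; 0, 0, 1]) (by
      simp [Matrix.det_fin_three])
    obtain ⟨d, ⟨v', w', -, hd⟩, e⟩ := h k ⟨1, 1, 1, 1, 0, 0, by simp [hk]⟩
    rw [SL3.mul_eq_mul_iff, hg, hd, hk] at e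
    have e00 := congrFun₂ e 0 0
    have e01 := congrFun₂ e 0 1
    have e12 := congrFun₂ e 1 2
    simp [Matrix.mul_apply, Fin.sum_univ_three] at e00 e01 e12
    grind
  apply Subtype.ext
  simp [hg, hv1, hw, Matrix.one_fin_three]

theorem stmt5 (F : Type*) [Field F] [Fintype F] (hodd : Odd (Fintype.card F))
    (G D H K : Subgroup (SL3 F))
    (hG : (G : Set (SL3 F)) = GSet F) (hD : (D : Set (SL3 F)) = DSet F)
    (hH : (H : Set (SL3 F)) = HSet F) (hK : (K : Set (SL3 F)) = KSet F) :
    -- `G` acts faithfully on the right cosets `D\G` by right multiplication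
    (∀ g ∈ G, (∀ g' ∈ G,
        (D : Set (SL3 F)) * ({g' * g} : Set (SL3 F)) = (D : Set (SL3 F)) * {g'}) → g = 1) ∧
    -- `H` acts transitively with trivial point stabilisers
    (∀ g₁ ∈ G, ∀ g₂ ∈ G, ∃ h ∈ H,
        (D : Set (SL3 F)) * ({g₁ * h} : Set (SL3 F)) = (D : Set (SL3 F)) * {g₂}) ∧
    (∀ h ∈ H, ∀ g ∈ G,
        (D : Set (SL3 F)) * ({g * h} : Set (SL3 F)) = (D : Set (SL3 F)) * {g} → h = 1) ∧
    -- `K` acts transitively with trivial point stabilisers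
    (∀ g₁ ∈ G, ∀ g₂ ∈ G, ∃ k ∈ K,
        (D : Set (SL3 F)) * ({g₁ * k} : Set (SL3 F)) = (D : Set (SL3 F)) * {g₂}) ∧
    (∀ k ∈ K, ∀ g ∈ G,
        (D : Set (SL3 F)) * ({g * k} : Set (SL3 F)) = (D : Set (SL3 F)) * {g} → k = 1) := by
  have memG (g : SL3 F) : g ∈ G ↔ g ∈ GSet F := by rw [← hG, SetLike.mem_coe]
  have memD (g : SL3 F) : g ∈ D ↔ g ∈ DSet F := by rw [← hD, SetLike.mem_coe]
  have memH (g : SL3 F) : g ∈ H ↔ g ∈ HSet F := by rw [← hH, SetLike.mem_coe]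
  have memK (g : SL3 F) : g ∈ K ↔ g ∈ KSet F := by rw [← hK, SetLike.mem_coe]
  simp only [Subgroup.coe_mul_singleton_eq_iff, memG, memD, memH, memK]
  refine ⟨fun g _ h => eq_one_of_forall_exists_DSet (two_ne_zero_of_odd_card hodd) h,
    fun _ h₁ _ h₂ => exists_HSet_mul_eq h₁ h₂, ?_, fun _ h₁ _ h₂ => exists_KSet_mul_eq h₁ h₂, ?_⟩
  · rintro h hh g hg ⟨d, hd, e⟩
    exact eq_one_of_mul_eq_of_mem_HSet hg hh hd e
  · rintro k hk g hg ⟨d, hd, e⟩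
    exact eq_one_of_mul_eq_of_mem_KSet hg hk hd e
end

section
/- The subgroups H and K are normal subgroups of G. Consequently, as regular subgroups of G (in its action on D\G), H and K lie in distinct G-conjugacy classes: no element of G conjugates H to K, since H ≠ K and each is its own conjugacy class. -/
open Matrix Pointwise

variable (F : Type*) [Field F]

theorem coe_conj_eq_of_mul_eq {F : Type*} [Field F] {g h : SL3 F}
    {M : Matrix (Fin 3) (Fin 3) F}
    (e : M * (g : Matrix (Fin 3) (Fin 3) F) = (g : Matrix (Fin 3) (Fin 3) F) * h) :
    ((g * h * g⁻¹ : SL3 F) : Matrix (Fin 3) (Fin 3) F) = M := by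
  have hg : (g : Matrix (Fin 3) (Fin 3) F) * ((g⁻¹ : SL3 F) : Matrix (Fin 3) (Fin 3) F) = 1 :=
    congrArg Subtype.val (mul_inv_cancel g)
  calc ((g * h * g⁻¹ : SL3 F) : Matrix (Fin 3) (Fin 3) F)
      = (g : Matrix (Fin 3) (Fin 3) F) * h * ((g⁻¹ : SL3 F) : Matrix (Fin 3) (Fin 3) F) := rfl
    _ = M := by rw [← e, mul_assoc, hg, mul_one]

theorem conj_mem_HSet {F : Type*} [Field F] {g h : SL3 F} (hg : g ∈ GSet F) (hh : h ∈ HSet F) :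
    g * h * g⁻¹ ∈ HSet F := by
  obtain ⟨a, b, c, x, y, z, -, -, hc, -, hg⟩ := hg
  obtain ⟨e, u, v, he, hh⟩ := hh
  have hcc : c * c = 1 := by rcases hc with rfl | rfl <;> ring
  refine ⟨e, (a * u + x * v + z - e * z) * c, (b * v + y - e * y) * c, he,
    coe_conj_eq_of_mul_eq ?_⟩
  rw [hg, hh]
  ext i j
  fin_cases i <;> fin_cases j <;> simp [hMat, Matrix.mul_apply, Fin.sum_univ_three] <;> grind

theorem conj_mem_KSet {F : Type*} [Field F] {g k : SL3 F} (hg : g ∈ GSet F) (hk : k ∈ KSet F) :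
    g * k * g⁻¹ ∈ KSet F := by
  obtain ⟨a, b, c, x, y, z, -, hb, hc, -, hg⟩ := hg
  obtain ⟨e, u, v, he, hk⟩ := hk
  have hbb : b * b = 1 := by rcases hb with rfl | rfl <;> ring
  have hcc : c * c = 1 := by rcases hc with rfl | rfl <;> ring
  refine ⟨e, (a * u + x * e - x) * b,
    (a * v + z * e - z - (a * u + x * e - x) * b * y) * c, he, coe_conj_eq_of_mul_eq ?_⟩
  rw [hg, hk]
  ext i j
  fin_cases i <;> fin_cases j <;> simp [Matrix.mul_apply, Fin.sum_univ_three] <;> grind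

theorem exists_mem_HSet_notMem_KSet (F : Type*) [Field F] : ∃ h ∈ HSet F, h ∉ KSet F := by
  refine ⟨⟨hMat F 1 0 1, by simp [hMat, Matrix.det_fin_three]⟩, ⟨1, 0, 1, Or.inl rfl, rfl⟩, ?_⟩
  rintro ⟨a, x, y, -, h⟩
  simpa [hMat] using congrFun (congrFun h 1) 2

theorem stmt6 (F : Type*) [Field F] [Fintype F] (hodd : Odd (Fintype.card F))
    (G D H K : Subgroup (SL3 F))
    (hG : (G : Set (SL3 F)) = GSet F) (hD : (D : Set (SL3 F)) = DSet F)
    (hH : (H : Set (SL3 F)) = HSet F) (hK : (K : Set (SL3 F)) = KSet F) :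
    -- `H` and `K` are normal in `G`
    (∀ g ∈ G, ∀ h ∈ H, g * h * g⁻¹ ∈ H) ∧
    (∀ g ∈ G, ∀ k ∈ K, g * k * g⁻¹ ∈ K) ∧
    -- consequently `H` and `K` lie in distinct `G`-conjugacy classes:
    H ≠ K ∧
    (∀ g ∈ G, (fun h => g * h * g⁻¹) '' (H : Set (SL3 F)) ≠ (K : Set (SL3 F))) := by
  have mem_G : ∀ g, g ∈ G ↔ g ∈ GSet F := fun g => by rw [← hG, SetLike.mem_coe]
  have mem_H : ∀ g, g ∈ H ↔ g ∈ HSet F := fun g => by rw [← hH, SetLike.mem_coe]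
  have mem_K : ∀ g, g ∈ K ↔ g ∈ KSet F := fun g => by rw [← hK, SetLike.mem_coe]
  have hHn : ∀ g ∈ G, ∀ h ∈ H, g * h * g⁻¹ ∈ H := fun g hg h hh =>
    (mem_H _).2 (conj_mem_HSet ((mem_G g).1 hg) ((mem_H h).1 hh))
  have hKn : ∀ g ∈ G, ∀ k ∈ K, g * k * g⁻¹ ∈ K := fun g hg k hk =>
    (mem_K _).2 (conj_mem_KSet ((mem_G g).1 hg) ((mem_K k).1 hk))
  obtain ⟨h, hhH, hhK⟩ := exists_mem_HSet_notMem_KSet F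
  rw [← mem_H] at hhH
  rw [← mem_K] at hhK
  refine ⟨hHn, hKn, fun e => hhK (e ▸ hhH), fun g hg e => hhK ?_⟩
  rw [← SetLike.mem_coe, ← e]
  exact ⟨g⁻¹ * h * g⁻¹⁻¹, hHn _ (inv_mem hg) h hhH, by group⟩
end

section
/- The orbits of D acting on H by conjugation are exactly the following sets: (1) the singleton orbits S_t = {h(1,t,0)} for each t ∈ F; (2) the coset orbits C_t ∪ C_{−t} for each t ∈ F\{0} (with C_t ∪ C_{−t} = C_{−t} ∪ C_t, so each unordered pair {t,−t} contributes one orbit); (3) the parabolic orbits P_t for each t ∈ F. -/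
open Matrix Pointwise

variable (F : Type*) [Field F]

theorem eq_inv_mul_mul_iff_coe_eq_hMat {F : Type*} [Field F] (h2 : (2 : F) ≠ 0) {g h d : SL3 F}
    {e p q a x : F} (ha : a = 1 ∨ a = -1)
    (hh : (h : Matrix (Fin 3) (Fin 3) F) = hMat F e p q)
    (hd : (d : Matrix (Fin 3) (Fin 3) F) = !![a, a * x, a * x ^ 2 / 2; 0, 1, x; 0, 0, a]) :
    g = d⁻¹ * h * d ↔ (g : Matrix (Fin 3) (Fin 3) F) =
      hMat F e (p - a * x * q - (e - 1) * x ^ 2 / 2) (a * q + (e - 1) * x) := by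
  have hmul : (d : Matrix (Fin 3) (Fin 3) F) *
      hMat F e (p - a * x * q - (e - 1) * x ^ 2 / 2) (a * q + (e - 1) * x) = h * d := by
    rw [hh, hd]
    ext i j
    fin_cases i <;> fin_cases j <;>
      simp [hMat, Matrix.mul_apply, Fin.sum_univ_three] <;>
      rcases ha with rfl | rfl <;> field_simp <;> ring
  rw [mul_assoc, eq_inv_mul_iff_mul_eq]
  constructor
  · intro hg
    have hinv : ((d⁻¹ : SL3 F) : Matrix (Fin 3) (Fin 3) F) * d = 1 := by
      rw [← Matrix.SpecialLinearGroup.coe_mul, inv_mul_cancel, Matrix.SpecialLinearGroup.coe_one]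
    have hg' : (d : Matrix (Fin 3) (Fin 3) F) * g = h * d := by
      rw [← Matrix.SpecialLinearGroup.coe_mul, hg, Matrix.SpecialLinearGroup.coe_mul]
    rw [← hmul] at hg'
    simpa only [← mul_assoc, hinv, one_mul] using
      congrArg (((d⁻¹ : SL3 F) : Matrix (Fin 3) (Fin 3) F) * ·) hg'
  · intro hg
    apply Subtype.ext
    rw [Matrix.SpecialLinearGroup.coe_mul, Matrix.SpecialLinearGroup.coe_mul, hg, hmul]

theorem mem_DOrbit_iff {F : Type*} [Field F] (h2 : (2 : F) ≠ 0) {g h : SL3 F} {e p q : F}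
    (hh : (h : Matrix (Fin 3) (Fin 3) F) = hMat F e p q) :
    g ∈ DOrbit F h ↔ ∃ a x : F, (a = 1 ∨ a = -1) ∧ (g : Matrix (Fin 3) (Fin 3) F) =
      hMat F e (p - a * x * q - (e - 1) * x ^ 2 / 2) (a * q + (e - 1) * x) := by
  constructor
  · rintro ⟨d, ⟨a, x, ha, hd⟩, hg⟩
    exact ⟨a, x, ha, (eq_inv_mul_mul_iff_coe_eq_hMat h2 ha hh hd).1 hg⟩
  · rintro ⟨a, x, ha, hg⟩
    have hdet : Matrix.det !![a, a * x, a * x ^ 2 / 2; 0, 1, x; 0, 0, a] = 1 := by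
      rcases ha with rfl | rfl <;> simp [Matrix.det_fin_three]
    exact ⟨⟨_, hdet⟩, ⟨a, x, ha, rfl⟩, (eq_inv_mul_mul_iff_coe_eq_hMat h2 ha hh rfl).2 hg⟩

theorem DOrbit_eq_Sorb {F : Type*} [Field F] (h2 : (2 : F) ≠ 0) {h : SL3 F} {p : F}
    (hh : (h : Matrix (Fin 3) (Fin 3) F) = hMat F 1 p 0) : DOrbit F h = Sorb F p := by
  ext g
  rw [mem_DOrbit_iff h2 hh]
  constructor
  · rintro ⟨a, x, -, hg⟩
    simpa [Sorb] using hg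
  · intro hg
    exact ⟨1, 0, Or.inl rfl, by simpa [Sorb] using hg⟩

theorem DOrbit_eq_Corb_union {F : Type*} [Field F] (h2 : (2 : F) ≠ 0) {h : SL3 F} {p q : F}
    (hq : q ≠ 0) (hh : (h : Matrix (Fin 3) (Fin 3) F) = hMat F 1 p q) :
    DOrbit F h = Corb F q ∪ Corb F (-q) := by
  ext g
  rw [mem_DOrbit_iff h2 hh]
  constructor
  · rintro ⟨a, x, rfl | rfl, hg⟩
    · exact Or.inl ⟨_, by simpa using hg⟩
    · exact Or.inr ⟨_, by simpa using hg⟩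
  · rintro (⟨z, hg⟩ | ⟨z, hg⟩)
    · refine ⟨1, (p - z) / q, Or.inl rfl, ?_⟩
      rw [hg]
      congr 1 <;> field_simp <;> ring
    · refine ⟨-1, (z - p) / q, Or.inr rfl, ?_⟩
      rw [hg]
      congr 1 <;> field_simp <;> ring

theorem DOrbit_eq_Porb {F : Type*} [Field F] (h2 : (2 : F) ≠ 0) {h : SL3 F} {p q : F}
    (hh : (h : Matrix (Fin 3) (Fin 3) F) = hMat F (-1) p q) :
    DOrbit F h = Porb F (p - (q / 2) ^ 2) := by
  ext g
  rw [mem_DOrbit_iff h2 hh]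
  constructor
  · rintro ⟨a, x, ha, hg⟩
    refine ⟨a * q / 2 - x, ?_⟩
    rw [hg]
    rcases ha with rfl | rfl <;> congr 1 <;> field_simp <;> ring
  · rintro ⟨z, hg⟩
    refine ⟨1, q / 2 - z, Or.inl rfl, ?_⟩
    rw [hg]
    congr 1 <;> field_simp <;> ring

theorem exists_mem_HSet_coe_eq_hMat {F : Type*} [Field F] {a : F} (ha : a = 1 ∨ a = -1) (x y : F) :
    ∃ h ∈ HSet F, (h : Matrix (Fin 3) (Fin 3) F) = hMat F a x y := by
  have hdet : (hMat F a x y).det = 1 := by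
    rcases ha with rfl | rfl <;> simp [hMat, Matrix.det_fin_three]
  exact ⟨⟨_, hdet⟩, ⟨a, x, y, ha, rfl⟩, rfl⟩

/-- The orbits of the conjugation action of `D` on `H` are exactly the singletons `S_t`,
the unions `C_t ∪ C_{-t}` (`t ≠ 0`) and the parabolics `P_t`. -/
theorem stmt7 (F : Type*) [Field F] [Fintype F] (hodd : Odd (Fintype.card F)) :
    {O : Set (SL3 F) | ∃ h ∈ HSet F, O = DOrbit F h} =
      {O : Set (SL3 F) | ∃ t : F, O = Sorb F t} ∪
      {O : Set (SL3 F) | ∃ t : F, t ≠ 0 ∧ O = Corb F t ∪ Corb F (-t)} ∪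
      {O : Set (SL3 F) | ∃ t : F, O = Porb F t} := by
  have h2 : (2 : F) ≠ 0 := by
    refine Ring.two_ne_zero fun hchar => ?_
    have := FiniteField.even_card_of_char_two hchar
    have := Nat.odd_iff.1 hodd
    omega
  ext O
  constructor
  · rintro ⟨h, ⟨a, x, y, rfl | rfl, hh⟩, rfl⟩
    · by_cases hy : y = 0
      · subst hy
        exact Or.inl (Or.inl ⟨x, DOrbit_eq_Sorb h2 hh⟩)
      · exact Or.inl (Or.inr ⟨y, hy, DOrbit_eq_Corb_union h2 hy hh⟩)
    · exact Or.inr ⟨_, DOrbit_eq_Porb h2 hh⟩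
  · rintro ((⟨t, rfl⟩ | ⟨t, ht, rfl⟩) | ⟨t, rfl⟩)
    · obtain ⟨h, hH, hh⟩ := exists_mem_HSet_coe_eq_hMat (Or.inl rfl) t 0
      exact ⟨h, hH, (DOrbit_eq_Sorb h2 hh).symm⟩
    · obtain ⟨h, hH, hh⟩ := exists_mem_HSet_coe_eq_hMat (Or.inl rfl) 0 t
      exact ⟨h, hH, (DOrbit_eq_Corb_union h2 ht hh).symm⟩
    · obtain ⟨h, hH, hh⟩ := exists_mem_HSet_coe_eq_hMat (Or.inr rfl) t 0
      exact ⟨h, hH, by simpa using (DOrbit_eq_Porb h2 hh).symm⟩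
end

section
/- For the conjugation action of D on H: each singleton orbit S_t has cardinality 1 and there are exactly q of them; each coset orbit C_t ∪ C_{−t} (t ≠ 0) has cardinality 2q and there are exactly (q−1)/2 of them; each parabolic orbit P_t has cardinality q and there are exactly q of them. In particular q·1 + ((q−1)/2)·2q + q·q = 2q² = |H|. -/
open Matrix Pointwise

variable (F : Type*) [Field F]

section

variable {F : Type*} [Field F]

theorem det_hMat {a : F} (ha : a = 1 ∨ a = -1) (x y : F) : (hMat F a x y).det = 1 := by
  rcases ha with rfl | rfl <;> simp [hMat, Matrix.det_fin_three]

/-- The matrix `h(a,x,y)` with `a = ±1` as an element of `SL₃(F)`. -/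
def hSL {a : F} (ha : a = 1 ∨ a = -1) (x y : F) : SL3 F := ⟨hMat F a x y, det_hMat ha x y⟩

theorem hMat_inj {a b x y z w : F} :
    hMat F a x y = hMat F b z w ↔ a = b ∧ x = z ∧ y = w := by
  constructor
  · intro h
    have h₀ := congrFun (congrFun h 0) 0
    have h₁ := congrFun (congrFun h 0) 2
    have h₂ := congrFun (congrFun h 1) 2
    simp only [hMat, Matrix.of_apply, Matrix.cons_val] at h₀ h₁ h₂
    exact ⟨h₀, h₁, h₂⟩
  · rintro ⟨rfl, rfl, rfl⟩
    rfl

theorem coe_eq_hMat_iff {a : F} (ha : a = 1 ∨ a = -1) {x y : F} {g : SL3 F} :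
    (g : Matrix (Fin 3) (Fin 3) F) = hMat F a x y ↔ g = hSL ha x y :=
  (Subtype.ext_iff (a1 := g) (a2 := hSL ha x y)).symm

theorem hSL_inj {a b x y z w : F} {ha : a = 1 ∨ a = -1} {hb : b = 1 ∨ b = -1} :
    hSL ha x y = hSL hb z w ↔ a = b ∧ x = z ∧ y = w :=
  Subtype.ext_iff.trans hMat_inj

theorem Sorb_eq_singleton (t : F) : Sorb F t = {hSL (.inl rfl) t 0} :=
  Set.ext fun _ => coe_eq_hMat_iff _

theorem Corb_eq_range (t : F) : Corb F t = Set.range fun z => hSL (.inl rfl) z t :=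
  Set.ext fun _ => exists_congr fun _ => (coe_eq_hMat_iff (.inl rfl)).trans eq_comm

theorem Porb_eq_range (t : F) :
    Porb F t = Set.range fun z => hSL (.inr rfl) (t + z ^ 2) (2 * z) :=
  Set.ext fun _ => exists_congr fun _ => (coe_eq_hMat_iff (.inr rfl)).trans eq_comm

theorem HSet_eq_range :
    HSet F = Set.range (Sum.elim (fun p : F × F => hSL (.inl rfl) p.1 p.2)
      (fun p : F × F => hSL (.inr rfl) p.1 p.2)) := by
  ext g
  simp only [HSet, Set.mem_ofPred_eq, Set.mem_range, Sum.exists, Sum.elim_inl, Sum.elim_inr,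
    Prod.exists]
  constructor
  · rintro ⟨a, x, y, rfl | rfl, h⟩
    · exact .inl ⟨x, y, ((coe_eq_hMat_iff _).1 h).symm⟩
    · exact .inr ⟨x, y, ((coe_eq_hMat_iff _).1 h).symm⟩
  · rintro (⟨x, y, rfl⟩ | ⟨x, y, rfl⟩)
    · exact ⟨1, x, y, .inl rfl, rfl⟩
    · exact ⟨-1, x, y, .inr rfl, rfl⟩

theorem hSL_mem_Corb {z t u : F} : hSL (.inl rfl) z t ∈ Corb F u ↔ t = u := by
  simp [Corb_eq_range, hSL_inj, eq_comm]

theorem Sorb_injective : Function.Injective (Sorb F) := fun t u h => by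
  rw [Sorb_eq_singleton, Sorb_eq_singleton, Set.singleton_eq_singleton_iff, hSL_inj] at h
  exact h.2.1

theorem Porb_injective (h₂ : (2 : F) ≠ 0) : Function.Injective (Porb F) := fun t u h => by
  have ht : hSL (.inr rfl) t 0 ∈ Porb F u := by
    rw [← h, Porb_eq_range]
    exact ⟨0, by simp⟩
  rw [Porb_eq_range] at ht
  obtain ⟨z, hz⟩ := ht
  obtain ⟨-, h₁, h₃⟩ := hSL_inj.1 hz
  obtain rfl : z = 0 := (mul_eq_zero.1 h₃).resolve_left h₂
  simpa using h₁.symm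

theorem Corb_union_eq_iff {t u : F} :
    Corb F t ∪ Corb F (-t) = Corb F u ∪ Corb F (-u) ↔ t = u ∨ t = -u := by
  constructor
  · intro h
    have ht : hSL (.inl rfl) 0 t ∈ Corb F u ∪ Corb F (-u) := h ▸ .inl (hSL_mem_Corb.2 rfl)
    simpa only [Set.mem_union, hSL_mem_Corb] using ht
  · rintro (rfl | rfl)
    · rfl
    · rw [neg_neg, Set.union_comm]

theorem card_Corb [Finite F] (t : F) : Nat.card (Corb F t) = Nat.card F := by
  rw [Corb_eq_range]
  exact Nat.card_range_of_injective fun x y h => (hSL_inj.1 h).2.1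

theorem disjoint_Corb {t u : F} (h : t ≠ u) : Disjoint (Corb F t) (Corb F u) := by
  rw [Set.disjoint_left, Corb_eq_range]
  rintro _ ⟨z, rfl⟩ hz
  exact h (hSL_mem_Corb.1 hz)

theorem card_Porb [Finite F] (h₂ : (2 : F) ≠ 0) (t : F) : Nat.card (Porb F t) = Nat.card F := by
  rw [Porb_eq_range]
  exact Nat.card_range_of_injective fun x y h => mul_left_cancel₀ h₂ (hSL_inj.1 h).2.2

theorem card_HSet [Finite F] (h : (1 : F) ≠ -1) : Nat.card (HSet F) = 2 * Nat.card F ^ 2 := by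
  rw [HSet_eq_range, Nat.card_range_of_injective, Nat.card_sum, Nat.card_prod]
  · ring
  · refine Function.Injective.sumElim (fun p q hpq => ?_) (fun p q hpq => ?_)
      fun p q hpq => h (hSL_inj.1 hpq).1
    · exact Prod.ext (hSL_inj.1 hpq).2.1 (hSL_inj.1 hpq).2.2
    · exact Prod.ext (hSL_inj.1 hpq).2.1 (hSL_inj.1 hpq).2.2

theorem card_setOf_Corb_union [Fintype F] (h : ∀ t : F, t ≠ 0 → t ≠ -t) :
    Nat.card {O : Set (SL3 F) | ∃ t : F, t ≠ 0 ∧ O = Corb F t ∪ Corb F (-t)} * 2 =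
      Fintype.card F - 1 := by
  classical
  have hO : {O : Set (SL3 F) | ∃ t : F, t ≠ 0 ∧ O = Corb F t ∪ Corb F (-t)} =
      ((Finset.univ.erase (0 : F)).image fun t => Corb F t ∪ Corb F (-t) :) := by
    ext O
    simp [eq_comm]
  rw [hO, Nat.card_coe_set_eq, Set.ncard_coe_finset, ← Finset.card_univ,
    ← Finset.card_erase_of_mem (Finset.mem_univ (0 : F)),
    Finset.card_eq_sum_card_image (fun t => Corb F t ∪ Corb F (-t)) (Finset.univ.erase (0 : F)),
    Finset.sum_const_nat]
  intro O hO
  obtain ⟨t, ht, rfl⟩ := Finset.mem_image.1 hO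
  have ht₀ : t ≠ 0 := Finset.ne_of_mem_erase ht
  rw [← Finset.card_pair (h t ht₀)]
  congr 1
  ext u
  simp only [Finset.mem_filter, Finset.mem_erase, Finset.mem_univ, and_true, Corb_union_eq_iff,
    Finset.mem_insert, Finset.mem_singleton, and_iff_right_iff_imp]
  rintro (rfl | rfl)
  · exact ht₀
  · exact neg_ne_zero.2 ht₀

end

theorem stmt8 (F : Type*) [Field F] [Fintype F] (hodd : Odd (Fintype.card F)) :
    -- singleton orbits: cardinality 1, exactly `q` of them
    (∀ t : F, Nat.card (Sorb F t) = 1) ∧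
    Nat.card {O : Set (SL3 F) | ∃ t : F, O = Sorb F t} = Fintype.card F ∧
    -- coset orbits: cardinality `2q`, exactly `(q-1)/2` of them
    (∀ t : F, t ≠ 0 → Nat.card ↥(Corb F t ∪ Corb F (-t)) = 2 * Fintype.card F) ∧
    Nat.card {O : Set (SL3 F) | ∃ t : F, t ≠ 0 ∧ O = Corb F t ∪ Corb F (-t)} =
      (Fintype.card F - 1) / 2 ∧
    -- parabolic orbits: cardinality `q`, exactly `q` of them
    (∀ t : F, Nat.card (Porb F t) = Fintype.card F) ∧
    Nat.card {O : Set (SL3 F) | ∃ t : F, O = Porb F t} = Fintype.card F ∧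
    -- the counting identity
    Fintype.card F * 1 + (Fintype.card F - 1) / 2 * (2 * Fintype.card F) +
        Fintype.card F * Fintype.card F = 2 * Fintype.card F ^ 2 ∧
    2 * Fintype.card F ^ 2 = Nat.card (HSet F) := by
  have h₂ : (2 : F) ≠ 0 := Ring.two_ne_zero fun h =>
    Nat.not_even_iff_odd.2 hodd (Nat.even_iff.2 (FiniteField.even_card_iff_char_two.1 h))
  have hne (t : F) (ht : t ≠ 0) : t ≠ -t := fun h =>
    mul_ne_zero h₂ ht (by rw [two_mul]; exact eq_neg_iff_add_eq_zero.1 h)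
  have hC := card_setOf_Corb_union hne
  refine ⟨fun t => ?_, ?_, fun t ht => ?_, by omega, fun t => ?_, ?_, ?_, ?_⟩
  · rw [Sorb_eq_singleton, Nat.card_unique]
  · rw [← Nat.card_eq_fintype_card, ← Nat.card_range_of_injective (Sorb_injective (F := F))]
    simp only [Set.range, eq_comm]
  · rw [Nat.card_coe_set_eq, Set.ncard_union_eq (disjoint_Corb (hne t ht)),
      ← Nat.card_coe_set_eq, ← Nat.card_coe_set_eq, card_Corb, card_Corb,
      Nat.card_eq_fintype_card, two_mul]
  · rw [card_Porb h₂, Nat.card_eq_fintype_card]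
  · rw [← Nat.card_eq_fintype_card, ← Nat.card_range_of_injective (Porb_injective h₂)]
    simp only [Set.range, eq_comm]
  · obtain ⟨k, hk⟩ := hodd
    have hk' : (Fintype.card F - 1) / 2 = k := by omega
    rw [hk', hk]
    ring
  · rw [card_HSet (hne 1 one_ne_zero), Nat.card_eq_fintype_card]
end

section
/- Let Ḡ ≤ Sym(H) be the permutation group on H generated by the right regular action of H on itself together with the conjugation action of D on H (this is the image of G acting on D\G, identified with H). Then Ḡ is 2-closed: every permutation σ of H with the property that for every pair (h₁,h₂) ∈ H×H, the pair (σ(h₁),σ(h₂)) lies in the same Ḡ-orbit of H×H as (h₁,h₂), belongs to Ḡ. -/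
open Matrix Pointwise

variable (F : Type*) [Field F]

/-- The permutations of `H` given by right multiplication by an element of `H`. -/
def RightMulPerms : Set (Equiv.Perm ↥(HSet F)) :=
  {σ | ∃ h ∈ HSet F, ∀ x : ↥(HSet F), (↑(σ x) : SL3 F) = ↑x * h}

/-- The permutations of `H` given by conjugation by an element of `D`. -/
def ConjPerms : Set (Equiv.Perm ↥(HSet F)) :=
  {σ | ∃ d ∈ DSet F, ∀ x : ↥(HSet F), (↑(σ x) : SL3 F) = d⁻¹ * ↑x * d}

/-- The permutation group `Ḡ ≤ Sym(H)` generated by the right regular action of `H`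
together with the conjugation action of `D` on `H`. -/
def GBar : Subgroup (Equiv.Perm ↥(HSet F)) :=
  Subgroup.closure (RightMulPerms F ∪ ConjPerms F)

variable {F}

/-- The element `h(a,x,y)` of `H`. -/
def hElt (a x y : F) (ha : a = 1 ∨ a = -1) : ↥(HSet F) :=
  ⟨⟨hMat F a x y, by rcases ha with rfl | rfl <;> simp [hMat, Matrix.det_fin_three]⟩,
    a, x, y, ha, rfl⟩

/-- The element of `D` with parameters `c` and `t`. -/
def dElt (c t : F) (hc : c = 1 ∨ c = -1) : SL3 F :=
  ⟨!![c, c * t, c * t ^ 2 / 2; 0, 1, t; 0, 0, c], by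
    rcases hc with rfl | rfl <;> simp [Matrix.det_fin_three]⟩

lemma dElt_mem (c t : F) (hc : c = 1 ∨ c = -1) : dElt c t hc ∈ DSet F := ⟨c, t, hc, rfl⟩

/-- The diagonal sign of an element of `H`. -/
def hSign (g : ↥(HSet F)) : F := (g : SL3 F).1 0 0

/-- The first translation coordinate of an element of `H`. -/
def hX (g : ↥(HSet F)) : F := (g : SL3 F).1 0 2

/-- The second translation coordinate of an element of `H`. -/
def hY (g : ↥(HSet F)) : F := (g : SL3 F).1 1 2

section Coordinates

variable (a x y : F) (ha : a = 1 ∨ a = -1)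

@[simp] lemma hSign_hElt : hSign (hElt a x y ha) = a := by simp [hSign, hElt, hMat]

@[simp] lemma hX_hElt : hX (hElt a x y ha) = x := by simp [hX, hElt, hMat]

@[simp] lemma hY_hElt : hY (hElt a x y ha) = y := by simp [hY, hElt, hMat]

end Coordinates

lemma exists_eq_hElt (g : ↥(HSet F)) : ∃ a x y ha, g = hElt a x y ha := by
  obtain ⟨g, a, x, y, ha, hg⟩ := g
  exact ⟨a, x, y, ha, Subtype.ext (Subtype.ext hg)⟩

lemma hSign_eq (g : ↥(HSet F)) : hSign g = 1 ∨ hSign g = -1 := by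
  obtain ⟨a, x, y, ha, rfl⟩ := exists_eq_hElt g
  simpa using ha

lemma hSign_mul_self (g : ↥(HSet F)) : hSign g * hSign g = 1 :=
  mul_self_eq_one_iff.2 (hSign_eq g)

lemma hSign_eq_iff {g h : ↥(HSet F)} : hSign g = hSign h ↔ hSign g * hSign h = 1 := by
  refine ⟨fun e ↦ e ▸ hSign_mul_self h, fun e ↦ ?_⟩
  linear_combination hSign h * e - hSign g * hSign_mul_self h

lemma hSign_eq_neg_iff {g h : ↥(HSet F)} :
    hSign g = -hSign h ↔ hSign g * hSign h = -1 := by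
  refine ⟨fun e ↦ by rw [e, neg_mul, hSign_mul_self], fun e ↦ ?_⟩
  linear_combination hSign h * e - hSign g * hSign_mul_self h

lemma hElt_ext {g h : ↥(HSet F)} (h₁ : hSign g = hSign h) (h₂ : hX g = hX h)
    (h₃ : hY g = hY h) : g = h := by
  obtain ⟨a, x, y, ha, rfl⟩ := exists_eq_hElt g
  obtain ⟨b, u, v, hb, rfl⟩ := exists_eq_hElt h
  simp only [hSign_hElt, hX_hElt, hY_hElt] at h₁ h₂ h₃
  subst h₁ h₂ h₃
  rfl

lemma mul_eq_one_or_neg_one {a b : F} (ha : a = 1 ∨ a = -1) (hb : b = 1 ∨ b = -1) :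
    a * b = 1 ∨ a * b = -1 := by
  rcases ha with rfl | rfl <;> rcases hb with rfl | rfl <;> simp

lemma hElt_mul (a x y b u v : F) (ha : a = 1 ∨ a = -1) (hb : b = 1 ∨ b = -1) :
    (hElt a x y ha : SL3 F) * hElt b u v hb =
      hElt (a * b) (x + a * u) (y + a * v) (mul_eq_one_or_neg_one ha hb) := by
  apply Subtype.ext
  rw [Matrix.SpecialLinearGroup.coe_mul]
  ext i j
  fin_cases i <;> fin_cases j <;>
    simp [hElt, hMat, Matrix.mul_apply, Fin.sum_univ_three, add_comm]

lemma conj_hElt (h2 : (2 : F) ≠ 0) (c t a x y : F) (hc : c = 1 ∨ c = -1)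
    (ha : a = 1 ∨ a = -1) :
    (dElt c t hc)⁻¹ * (hElt a x y ha : SL3 F) * dElt c t hc =
      hElt a (x - (a - 1) * t ^ 2 / 2 - c * t * y) ((a - 1) * t + c * y) ha := by
  rw [mul_assoc, inv_mul_eq_iff_eq_mul]
  apply Subtype.ext
  rw [Matrix.SpecialLinearGroup.coe_mul, Matrix.SpecialLinearGroup.coe_mul]
  ext i j
  rcases hc with rfl | rfl <;> fin_cases i <;> fin_cases j <;>
    simp [hElt, dElt, hMat, Matrix.mul_apply, Fin.sum_univ_three] <;>
    field_simp <;> ring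

/-- Preservation of the quantities that separate the orbits of `GBar F` on pairs. -/
structure PreservesPairs (σ : Equiv.Perm ↥(HSet F)) : Prop where
  sign : ∀ g h, hSign (σ g) * hSign (σ h) = hSign g * hSign h
  sq : ∀ g h, hSign g = hSign h → (hY (σ g) - hY (σ h)) ^ 2 = (hY g - hY h) ^ 2
  diff : ∀ g h, hSign g = hSign h → hY g = hY h → hX (σ g) - hX (σ h) = hX g - hX h
  parab : ∀ g h, hSign g = -hSign h →
    4 * (hX (σ g) + hX (σ h)) - (hY (σ g) + hY (σ h)) ^ 2 =
      4 * (hX g + hX h) - (hY g + hY h) ^ 2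

namespace PreservesPairs

variable {σ τ : Equiv.Perm ↥(HSet F)}

lemma sign_eq (hσ : PreservesPairs σ) {g h : ↥(HSet F)} :
    hSign (σ g) = hSign (σ h) ↔ hSign g = hSign h := by
  rw [hSign_eq_iff, hSign_eq_iff, hσ.sign]

lemma sign_eq_neg (hσ : PreservesPairs σ) {g h : ↥(HSet F)} :
    hSign (σ g) = -hSign (σ h) ↔ hSign g = -hSign h := by
  rw [hSign_eq_neg_iff, hSign_eq_neg_iff, hσ.sign]

lemma y_eq (hσ : PreservesPairs σ) {g h : ↥(HSet F)} (hs : hSign g = hSign h) :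
    hY (σ g) = hY (σ h) ↔ hY g = hY h := by
  rw [← sub_eq_zero, ← sq_eq_zero_iff, hσ.sq g h hs, sq_eq_zero_iff, sub_eq_zero]

lemma one : PreservesPairs (1 : Equiv.Perm ↥(HSet F)) where
  sign _ _ := rfl
  sq _ _ _ := rfl
  diff _ _ _ _ := rfl
  parab _ _ _ := rfl

lemma mul (hσ : PreservesPairs σ) (hτ : PreservesPairs τ) : PreservesPairs (σ * τ) where
  sign g h := (hσ.sign _ _).trans (hτ.sign g h)
  sq g h hs := (hσ.sq _ _ (hτ.sign_eq.2 hs)).trans (hτ.sq g h hs)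
  diff g h hs hy :=
    (hσ.diff _ _ (hτ.sign_eq.2 hs) ((hτ.y_eq hs).2 hy)).trans (hτ.diff g h hs hy)
  parab g h hs := (hσ.parab _ _ (hτ.sign_eq_neg.2 hs)).trans (hτ.parab g h hs)

lemma inv (hσ : PreservesPairs σ) : PreservesPairs σ⁻¹ where
  sign g h := by
    obtain ⟨g, rfl⟩ := σ.surjective g
    obtain ⟨h, rfl⟩ := σ.surjective h
    simpa using (hσ.sign g h).symm
  sq g h hs := by
    obtain ⟨g, rfl⟩ := σ.surjective g
    obtain ⟨h, rfl⟩ := σ.surjective h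
    simpa using (hσ.sq g h (hσ.sign_eq.1 hs)).symm
  diff g h hs hy := by
    obtain ⟨g, rfl⟩ := σ.surjective g
    obtain ⟨h, rfl⟩ := σ.surjective h
    have hs := hσ.sign_eq.1 hs
    simpa using (hσ.diff g h hs ((hσ.y_eq hs).1 hy)).symm
  parab g h hs := by
    obtain ⟨g, rfl⟩ := σ.surjective g
    obtain ⟨h, rfl⟩ := σ.surjective h
    simpa using (hσ.parab g h (hσ.sign_eq_neg.1 hs)).symm

lemma of_rightMul (hσ : σ ∈ RightMulPerms F) : PreservesPairs σ := by
  obtain ⟨k, hk, hσ⟩ := hσ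
  obtain ⟨b, u, v, hb, hk⟩ := exists_eq_hElt ⟨k, hk⟩
  obtain rfl : k = hElt b u v hb := congrArg Subtype.val hk
  have key (a x y : F) (ha : a = 1 ∨ a = -1) : σ (hElt a x y ha) =
      hElt (a * b) (x + a * u) (y + a * v) (mul_eq_one_or_neg_one ha hb) :=
    Subtype.ext ((hσ _).trans (hElt_mul ..))
  have hbb : b * b = 1 := by rcases hb with rfl | rfl <;> simp
  constructor <;> intro g h <;> obtain ⟨a, x, y, ha, rfl⟩ := exists_eq_hElt g <;>
    obtain ⟨a', x', y', ha', rfl⟩ := exists_eq_hElt h <;>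
    simp only [key, hSign_hElt, hX_hElt, hY_hElt]
  · linear_combination a * a' * hbb
  · rintro rfl
    ring
  · rintro rfl -
    ring
  · rintro rfl
    ring

lemma of_conj (h2 : (2 : F) ≠ 0) (hσ : σ ∈ ConjPerms F) : PreservesPairs σ := by
  obtain ⟨d, ⟨c, t, hc, hd⟩, hσ⟩ := hσ
  obtain rfl : d = dElt c t hc := Subtype.ext hd
  have key (a x y : F) (ha : a = 1 ∨ a = -1) : σ (hElt a x y ha) =
      hElt a (x - (a - 1) * t ^ 2 / 2 - c * t * y) ((a - 1) * t + c * y) ha :=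
    Subtype.ext ((hσ _).trans (conj_hElt h2 ..))
  have hcc : c * c = 1 := by rcases hc with rfl | rfl <;> simp
  constructor <;> intro g h <;> obtain ⟨a, x, y, ha, rfl⟩ := exists_eq_hElt g <;>
    obtain ⟨a', x', y', ha', rfl⟩ := exists_eq_hElt h <;>
    simp only [key, hSign_hElt, hX_hElt, hY_hElt]
  · rintro rfl
    linear_combination (y - y') ^ 2 * hcc
  · rintro rfl rfl
    ring
  · rintro rfl
    field_simp
    linear_combination -2 * (y + y') ^ 2 * hcc

lemma of_mem_GBar (h2 : (2 : F) ≠ 0) (hσ : σ ∈ GBar F) : PreservesPairs σ := by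
  induction hσ using Subgroup.closure_induction with
  | mem τ hτ => exact hτ.elim of_rightMul (of_conj h2)
  | one => exact one
  | mul _ _ _ _ h₁ h₂ => exact h₁.mul h₂
  | inv _ _ h => exact h.inv

lemma sign_apply (hσ : PreservesPairs σ) {g : ↥(HSet F)} (hg : σ g = g) (h : ↥(HSet F)) :
    hSign (σ h) = hSign h := by
  have := hσ.sign g h
  rw [hg] at this
  refine mul_left_cancel₀ ?_ this
  rcases hSign_eq g with e | e <;> simp [e]

/-- A permutation preserving pairs and fixing `h(1,0,0)`, `h(-1,0,0)` and `h(1,0,1)` is trivial. -/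
lemma eq_one (h2 : (2 : F) ≠ 0) (hσ : PreservesPairs σ)
    (h₁ : σ (hElt 1 0 0 (.inl rfl)) = hElt 1 0 0 (.inl rfl))
    (h₂ : σ (hElt (-1) 0 0 (.inr rfl)) = hElt (-1) 0 0 (.inr rfl))
    (h₃ : σ (hElt 1 0 1 (.inl rfl)) = hElt 1 0 1 (.inl rfl)) : σ = 1 := by
  have h4 : (4 : F) ≠ 0 := by
    rw [show (4 : F) = 2 * 2 by norm_num]
    exact mul_ne_zero h2 h2
  have neg (g : ↥(HSet F)) (hg : hSign g = -1) : σ g = g := by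
    have e₁ := hσ.sq g _ (hg.trans (hSign_hElt (-1) 0 0 (.inr rfl)).symm)
    have e₂ := hσ.parab g (hElt 1 0 0 (.inl rfl)) (by simpa using hg)
    have e₃ := hσ.parab g (hElt 1 0 1 (.inl rfl)) (by simpa using hg)
    rw [h₂] at e₁
    rw [h₁] at e₂
    rw [h₃] at e₃
    simp only [hX_hElt, hY_hElt] at e₁ e₂ e₃
    refine hElt_ext (hσ.sign_apply h₁ g) (mul_left_cancel₀ h4 ?_) (mul_left_cancel₀ h2 ?_)
    · linear_combination e₁ + e₂
    · linear_combination e₂ - e₃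
  have h₄ := neg (hElt (-1) 0 1 (.inr rfl)) (by simp)
  ext1 g
  rcases hSign_eq g with hg | hg
  · have e₁ := hσ.sq g _ (hg.trans (hSign_hElt 1 0 0 (.inl rfl)).symm)
    have e₂ := hσ.parab g (hElt (-1) 0 0 (.inr rfl)) (by simpa using hg)
    have e₃ := hσ.parab g (hElt (-1) 0 1 (.inr rfl)) (by simpa using hg)
    rw [h₁] at e₁
    rw [h₂] at e₂
    rw [h₄] at e₃
    simp only [hX_hElt, hY_hElt] at e₁ e₂ e₃
    refine hElt_ext (hσ.sign_apply h₁ g) (mul_left_cancel₀ h4 ?_) (mul_left_cancel₀ h2 ?_)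
    · simp only [Equiv.Perm.one_apply]
      linear_combination e₁ + e₂
    · simp only [Equiv.Perm.one_apply]
      linear_combination e₂ - e₃
  · exact neg g hg

end PreservesPairs

section Finite

variable [Finite F]

lemma exists_rightMul_mem_GBar (b u v : F) (hb : b = 1 ∨ b = -1) :
    ∃ τ ∈ GBar F, ∀ a x y ha, τ (hElt a x y ha) =
      hElt (a * b) (x + a * u) (y + a * v) (mul_eq_one_or_neg_one ha hb) := by
  let k : SL3 F := hElt b u v hb
  let τ : Equiv.Perm ↥(HSet F) := (Equiv.mulRight k).subtypePermOfFintype (p := (· ∈ HSet F))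
    fun g hg ↦ by
      obtain ⟨a, x, y, ha, e⟩ := exists_eq_hElt ⟨g, hg⟩
      obtain rfl : g = hElt a x y ha := congrArg Subtype.val e
      exact Set.mem_of_eq_of_mem (hElt_mul a x y b u v ha hb) (Subtype.coe_prop _)
  have hτ (g : ↥(HSet F)) : (τ g : SL3 F) = g * k := rfl
  exact ⟨τ, Subgroup.subset_closure (.inl ⟨k, Subtype.coe_prop _, hτ⟩),
    fun a x y ha ↦ Subtype.ext ((hτ _).trans (hElt_mul ..))⟩

lemma exists_conj_mem_GBar (h2 : (2 : F) ≠ 0) (c t : F) (hc : c = 1 ∨ c = -1) :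
    ∃ τ ∈ GBar F, ∀ a x y ha, τ (hElt a x y ha) =
      hElt a (x - (a - 1) * t ^ 2 / 2 - c * t * y) ((a - 1) * t + c * y) ha := by
  let d : SL3 F := dElt c t hc
  let τ : Equiv.Perm ↥(HSet F) :=
    Equiv.Perm.subtypePermOfFintype ((Equiv.mulLeft d⁻¹).trans (Equiv.mulRight d))
      (p := (· ∈ HSet F)) fun g hg ↦ by
        obtain ⟨a, x, y, ha, e⟩ := exists_eq_hElt ⟨g, hg⟩
        obtain rfl : g = hElt a x y ha := congrArg Subtype.val e
        exact Set.mem_of_eq_of_mem (conj_hElt h2 c t a x y hc ha) (Subtype.coe_prop _)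
  have hτ (g : ↥(HSet F)) : (τ g : SL3 F) = d⁻¹ * g * d := rfl
  exact ⟨τ, Subgroup.subset_closure (.inr ⟨d, dElt_mem c t hc, hτ⟩),
    fun a x y ha ↦ Subtype.ext ((hτ _).trans (conj_hElt h2 ..))⟩

lemma PreservesPairs.mem_GBar (h2 : (2 : F) ≠ 0) {σ : Equiv.Perm ↥(HSet F)}
    (hσ : PreservesPairs σ) : σ ∈ GBar F := by
  have h4 : (4 : F) ≠ 0 := by
    rw [show (4 : F) = 2 * 2 by norm_num]
    exact mul_ne_zero h2 h2
  -- Move `h(1,0,0)` back to itself.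
  obtain ⟨b, u, v, hb, e₁⟩ := exists_eq_hElt (σ (hElt 1 0 0 (.inl rfl)))
  obtain ⟨ρ, hρ, ρ_apply⟩ := exists_rightMul_mem_GBar b u v hb
  rw [← Subgroup.mul_mem_cancel_left _ (inv_mem hρ)]
  replace hσ := (of_mem_GBar h2 hρ).inv.mul hσ
  replace e₁ : (ρ⁻¹ * σ) (hElt 1 0 0 (.inl rfl)) = hElt 1 0 0 (.inl rfl) := by
    rw [Equiv.Perm.mul_apply, Equiv.Perm.inv_eq_iff_eq, e₁, ρ_apply]
    simp
  generalize ρ⁻¹ * σ = σ at hσ e₁ ⊢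
  -- Move `h(-1,0,0)` back to itself.
  have s₂ := hσ.sign_apply e₁ (hElt (-1) 0 0 (.inr rfl))
  have p₂ := hσ.parab (hElt 1 0 0 (.inl rfl)) (hElt (-1) 0 0 (.inr rfl)) (by simp)
  obtain ⟨a, x, y, ha, e₂⟩ := exists_eq_hElt (σ (hElt (-1) 0 0 (.inr rfl)))
  simp only [e₁, e₂, hSign_hElt, hX_hElt, hY_hElt] at s₂ p₂
  subst s₂
  obtain ⟨κ, hκ, κ_apply⟩ := exists_conj_mem_GBar h2 1 (-y / 2) (.inl rfl)
  rw [← Subgroup.mul_mem_cancel_left _ (inv_mem hκ)]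
  replace hσ := (of_mem_GBar h2 hκ).inv.mul hσ
  replace e₁ : (κ⁻¹ * σ) (hElt 1 0 0 (.inl rfl)) = hElt 1 0 0 (.inl rfl) := by
    rw [Equiv.Perm.mul_apply, Equiv.Perm.inv_eq_iff_eq, e₁, κ_apply]
    simp
  replace e₂ : (κ⁻¹ * σ) (hElt (-1) 0 0 (.inr rfl)) = hElt (-1) 0 0 (.inr rfl) := by
    rw [Equiv.Perm.mul_apply, Equiv.Perm.inv_eq_iff_eq, e₂, κ_apply]
    refine hElt_ext (by simp) ?_ ?_ <;> simp only [hX_hElt, hY_hElt]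
    · refine mul_left_cancel₀ h4 ?_
      field_simp
      linear_combination 2 * p₂
    · field_simp
      ring
  generalize κ⁻¹ * σ = σ at hσ e₁ e₂ ⊢
  -- Move `h(1,0,1)` back to itself.
  clear p₂ κ_apply
  have s₃ := hσ.sign_apply e₁ (hElt 1 0 1 (.inl rfl))
  have q₃ := hσ.sq (hElt 1 0 1 (.inl rfl)) (hElt 1 0 0 (.inl rfl)) (by simp)
  have p₃ := hσ.parab (hElt 1 0 1 (.inl rfl)) (hElt (-1) 0 0 (.inr rfl)) (by simp)
  obtain ⟨a, x, c, ha, e₃⟩ := exists_eq_hElt (σ (hElt 1 0 1 (.inl rfl)))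
  simp only [e₁, e₂, e₃, hSign_hElt, hX_hElt, hY_hElt] at s₃ q₃ p₃
  subst s₃
  obtain rfl : x = 0 := mul_left_cancel₀ h4 (by linear_combination p₃ + q₃)
  have hc : c = 1 ∨ c = -1 := by simpa using q₃
  obtain ⟨κ, hκ, κ_apply⟩ := exists_conj_mem_GBar h2 c 0 hc
  rw [← Subgroup.mul_mem_cancel_left _ (inv_mem hκ)]
  suffices κ⁻¹ * σ = 1 from this ▸ one_mem _
  refine ((of_mem_GBar h2 hκ).inv.mul hσ).eq_one h2 ?_ ?_ ?_ <;>
    rw [Equiv.Perm.mul_apply, Equiv.Perm.inv_eq_iff_eq]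
  · simp [e₁, κ_apply]
  · simp [e₂, κ_apply]
  · simp [e₃, κ_apply]

end Finite

variable (F)

/-- `Ḡ` is 2-closed: any permutation of `H` preserving every `Ḡ`-orbit on `H × H`
belongs to `Ḡ`. -/
theorem stmt11 (F : Type*) [Field F] [Fintype F] (hodd : Odd (Fintype.card F)) :
    ∀ σ : Equiv.Perm ↥(HSet F),
      (∀ x y : ↥(HSet F), ∃ τ ∈ GBar F, τ x = σ x ∧ τ y = σ y) → σ ∈ GBar F := by
  intro σ hσ
  have h2 : (2 : F) ≠ 0 := Ring.two_ne_zero fun h ↦ by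
    have := FiniteField.even_card_of_char_two h
    rw [Nat.odd_iff] at hodd
    omega
  refine PreservesPairs.mem_GBar h2 ⟨fun g h ↦ ?_, fun g h ↦ ?_, fun g h ↦ ?_, fun g h ↦ ?_⟩ <;>
    obtain ⟨τ, hτ, hg, hh⟩ := hσ g h <;> rw [← hg, ← hh]
  · exact (PreservesPairs.of_mem_GBar h2 hτ).sign g h
  · exact (PreservesPairs.of_mem_GBar h2 hτ).sq g h
  · exact (PreservesPairs.of_mem_GBar h2 hτ).diff g h
  · exact (PreservesPairs.of_mem_GBar h2 hτ).parab g h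
end

section
/- Let s = [[0,0,1],[0,1,0],[1,0,0]] and define α : GL₃(F) → GL₃(F) by g^α = s⁻¹·(g⁻¹)ᵀ·s, where (·)ᵀ denotes matrix transpose. Then α is a group automorphism of GL₃(F), and it satisfies G^α = G, D^α = D, H^α = K and K^α = H. -/
open Matrix Pointwise

abbrev GL3 (F : Type*) [Field F] := Matrix.GeneralLinearGroup (Fin 3) F

variable (F : Type*) [Field F]

/-- The subgroup `G`, as a set of invertible matrices. -/
def GSetGL : Set (GL3 F) :=
  {g | ∃ a b c x y z : F, (a = 1 ∨ a = -1) ∧ (b = 1 ∨ b = -1) ∧ (c = 1 ∨ c = -1) ∧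
    a * b * c = 1 ∧ (g : Matrix (Fin 3) (Fin 3) F) = !![a, x, z; 0, b, y; 0, 0, c]}

/-- The subgroup `D`, as a set of invertible matrices. -/
def DSetGL : Set (GL3 F) :=
  {g | ∃ a x : F, (a = 1 ∨ a = -1) ∧
    (g : Matrix (Fin 3) (Fin 3) F) = !![a, a * x, a * x ^ 2 / 2; 0, 1, x; 0, 0, a]}

/-- The subgroup `H`, as a set of invertible matrices. -/
def HSetGL : Set (GL3 F) :=
  {g | ∃ a x y : F, (a = 1 ∨ a = -1) ∧ (g : Matrix (Fin 3) (Fin 3) F) = hMat F a x y}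

/-- The subgroup `K`, as a set of invertible matrices. -/
def KSetGL : Set (GL3 F) :=
  {g | ∃ a x y : F, (a = 1 ∨ a = -1) ∧
    (g : Matrix (Fin 3) (Fin 3) F) = !![1, x, y; 0, a, 0; 0, 0, a]}

/-- The matrix `s`. -/
def sMat : Matrix (Fin 3) (Fin 3) F := !![0, 0, 1; 0, 1, 0; 1, 0, 0]

variable {F}

theorem sMat_mul_sMat : sMat F * sMat F = 1 := by
  ext i j
  fin_cases i <;> fin_cases j <;> simp [sMat, Matrix.mul_apply, Fin.sum_univ_three]

theorem sMat_inv : (sMat F)⁻¹ = sMat F :=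
  Matrix.inv_eq_right_inv sMat_mul_sMat

theorem sMat_mul_sMat_mul (A : Matrix (Fin 3) (Fin 3) F) : sMat F * (sMat F * A) = A := by
  rw [← Matrix.mul_assoc, sMat_mul_sMat, Matrix.one_mul]

theorem sMat_transpose : (sMat F)ᵀ = sMat F := by
  ext i j
  fin_cases i <;> fin_cases j <;> simp [sMat]

/-- The map `g ↦ s (g⁻¹)ᵀ s` on `GL₃(F)`. -/
def antiInv (g : GL3 F) : GL3 F where
  val := sMat F * ((g⁻¹ : GL3 F) : Matrix (Fin 3) (Fin 3) F)ᵀ * sMat F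
  inv := sMat F * (g : Matrix (Fin 3) (Fin 3) F)ᵀ * sMat F
  val_inv := by
    simp only [Matrix.mul_assoc, sMat_mul_sMat_mul]
    rw [← Matrix.mul_assoc _ᵀ, ← Matrix.transpose_mul, ← Units.val_mul, mul_inv_cancel,
      Units.val_one, Matrix.transpose_one, Matrix.one_mul, sMat_mul_sMat]
  inv_val := by
    simp only [Matrix.mul_assoc, sMat_mul_sMat_mul]
    rw [← Matrix.mul_assoc _ᵀ, ← Matrix.transpose_mul, ← Units.val_mul, inv_mul_cancel,
      Units.val_one, Matrix.transpose_one, Matrix.one_mul, sMat_mul_sMat]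

theorem coe_antiInv (g : GL3 F) :
    (antiInv g : Matrix (Fin 3) (Fin 3) F) =
      sMat F * ((g⁻¹ : GL3 F) : Matrix (Fin 3) (Fin 3) F)ᵀ * sMat F := rfl

theorem coe_inv_antiInv (g : GL3 F) :
    (((antiInv g)⁻¹ : GL3 F) : Matrix (Fin 3) (Fin 3) F) =
      sMat F * (g : Matrix (Fin 3) (Fin 3) F)ᵀ * sMat F := rfl

theorem antiInv_antiInv (g : GL3 F) : antiInv (antiInv g) = g := by
  apply Units.ext
  rw [coe_antiInv, coe_inv_antiInv]
  simp only [Matrix.transpose_mul, Matrix.transpose_transpose, sMat_transpose, Matrix.mul_assoc,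
    sMat_mul_sMat_mul, sMat_mul_sMat, Matrix.mul_one]

theorem antiInv_mul (g h : GL3 F) : antiInv (g * h) = antiInv g * antiInv h := by
  apply Units.ext
  rw [Units.val_mul, coe_antiInv, coe_antiInv, coe_antiInv, _root_.mul_inv_rev, Units.val_mul,
    Matrix.transpose_mul]
  simp only [Matrix.mul_assoc, sMat_mul_sMat_mul]

/-- The map `g ↦ s (g⁻¹)ᵀ s` as an automorphism of `GL₃(F)`. -/
def antiInvEquiv : GL3 F ≃* GL3 F where
  toFun := antiInv
  invFun := antiInv
  left_inv := antiInv_antiInv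
  right_inv := antiInv_antiInv
  map_mul' := antiInv_mul

/-- The automorphism reflects the inverse matrix in its antidiagonal. -/
theorem coe_antiInv_of_mul_eq_one {g : GL3 F} {p q r t u v w m n : F}
    (h : (g : Matrix (Fin 3) (Fin 3) F) * !![p, q, r; t, u, v; w, m, n] = 1) :
    (antiInv g : Matrix (Fin 3) (Fin 3) F) = !![n, v, r; m, u, q; w, t, p] := by
  have hinv : ((g⁻¹ : GL3 F) : Matrix (Fin 3) (Fin 3) F) = !![p, q, r; t, u, v; w, m, n] := by
    rw [Matrix.coe_units_inv]
    exact Matrix.inv_eq_right_inv h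
  rw [coe_antiInv, hinv]
  ext i j
  fin_cases i <;> fin_cases j <;>
    simp [sMat, Matrix.mul_apply, Matrix.vecMul, dotProduct, Fin.sum_univ_three]

theorem image_antiInvEquiv_eq {X Y : Set (GL3 F)} (hXY : ∀ g ∈ X, antiInv g ∈ Y)
    (hYX : ∀ g ∈ Y, antiInv g ∈ X) : antiInvEquiv '' X = Y := by
  apply Set.Subset.antisymm
  · rintro _ ⟨g, hg, rfl⟩
    exact hXY g hg
  · intro g hg
    exact ⟨antiInv g, hYX g hg, antiInv_antiInv g⟩

theorem antiInv_mem_GSetGL {g : GL3 F} (hg : g ∈ GSetGL F) : antiInv g ∈ GSetGL F := by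
  obtain ⟨a, b, c, x, y, z, ha, hb, hc, habc, hg⟩ := hg
  have ha2 := mul_self_eq_one_of_sign ha
  have hb2 := mul_self_eq_one_of_sign hb
  have hc2 := mul_self_eq_one_of_sign hc
  refine ⟨c, b, a, -(b * c * y), -(a * b * x), a * b * c * x * y - a * c * z, hc, hb, ha,
    by linear_combination habc, coe_antiInv_of_mul_eq_one ?_⟩
  rw [hg]
  ext i j
  fin_cases i <;> fin_cases j <;> simp [Matrix.mul_apply, Fin.sum_univ_three] <;> grind

theorem antiInv_mem_DSetGL (h2 : (2 : F) ≠ 0) {g : GL3 F} (hg : g ∈ DSetGL F) :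
    antiInv g ∈ DSetGL F := by
  obtain ⟨a, x, ha, hg⟩ := hg
  have ha2 := mul_self_eq_one_of_sign ha
  refine ⟨a, -x, ha, coe_antiInv_of_mul_eq_one ?_⟩
  rw [hg]
  ext i j
  fin_cases i <;> fin_cases j <;> simp [Matrix.mul_apply, Fin.sum_univ_three] <;> grind

theorem antiInv_mem_KSetGL {g : GL3 F} (hg : g ∈ HSetGL F) : antiInv g ∈ KSetGL F := by
  obtain ⟨a, x, y, ha, hg⟩ := hg
  have ha2 := mul_self_eq_one_of_sign ha
  refine ⟨a, -(a * y), -(a * x), ha, coe_antiInv_of_mul_eq_one ?_⟩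
  rw [hg, hMat]
  ext i j
  fin_cases i <;> fin_cases j <;> simp [Matrix.mul_apply, Fin.sum_univ_three] <;> grind

theorem antiInv_mem_HSetGL {g : GL3 F} (hg : g ∈ KSetGL F) : antiInv g ∈ HSetGL F := by
  obtain ⟨a, x, y, ha, hg⟩ := hg
  have ha2 := mul_self_eq_one_of_sign ha
  refine ⟨a, -(a * y), -(a * x), ha, coe_antiInv_of_mul_eq_one ?_⟩
  rw [hg]
  ext i j
  fin_cases i <;> fin_cases j <;> simp [Matrix.mul_apply, Fin.sum_univ_three] <;> grind

/-- The map `g ↦ s⁻¹ (g⁻¹)ᵀ s` is a group automorphism of `GL₃(F)` preserving `G` and `D`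
and interchanging `H` and `K`. -/
theorem stmt13 (F : Type*) [Field F] [Fintype F] (hodd : Odd (Fintype.card F)) :
    ∃ α : GL3 F ≃* GL3 F,
      (∀ g : GL3 F,
        ((α g : GL3 F) : Matrix (Fin 3) (Fin 3) F) =
          (sMat F)⁻¹ * ((g⁻¹ : GL3 F) : Matrix (Fin 3) (Fin 3) F)ᵀ * sMat F) ∧
      α '' GSetGL F = GSetGL F ∧ α '' DSetGL F = DSetGL F ∧
      α '' HSetGL F = KSetGL F ∧ α '' KSetGL F = HSetGL F := by
  have h2 : (2 : F) ≠ 0 := Ring.two_ne_zero fun h =>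
    Nat.not_even_iff_odd.mpr hodd (FiniteField.even_card_iff_char_two.mp h |> Nat.even_iff.mpr)
  refine ⟨antiInvEquiv, fun g => ?_,
    image_antiInvEquiv_eq (fun _ => antiInv_mem_GSetGL) (fun _ => antiInv_mem_GSetGL),
    image_antiInvEquiv_eq (fun _ => antiInv_mem_DSetGL h2) (fun _ => antiInv_mem_DSetGL h2),
    image_antiInvEquiv_eq (fun _ => antiInv_mem_KSetGL) (fun _ => antiInv_mem_HSetGL),
    image_antiInvEquiv_eq (fun _ => antiInv_mem_HSetGL) (fun _ => antiInv_mem_KSetGL)⟩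
  rw [sMat_inv]
  rfl
end
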